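/- Let 0 < ε < 1 and let K be a convex body in ℝⁿ with V(K) = V(B). If 𝓔_{-1}(K)/(n V(B)) ≥ 1 − ε, then δ_H(K − e_{-2}(K), B_r)^{n+1} ≤ (2 n V(B)/α_n) · D(K)² · (D(K) + 2/(1−ε))^{n−1} · ε, where r := (∫_{S^{n-1}} dθ)^{1/2} / (∫_{S^{n-1}} (s_K(u) − e_{-2}(K)·u)^{-2} dθ)^{1/2} satisfies 1 ≤ r ≤ 1/(1−ε), B_r is the ball of radius r centered at the origin, and α_n = n V(B) β(3, n−1)/β(1/2, (n−1)/2) with β the beta integral. -/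

import Mathlib

open MeasureTheory Metric Real Set
open scoped Pointwise RealInnerProductSpace

noncomputable section

/-- The surface measure `dθ` on the unit sphere `S^{n-1}` of `ℝⁿ`
(its total mass is `n·V(B)`). -/
def sphMeasure (n : ℕ) : Measure (Metric.sphere (0 : EuclideanSpace ℝ (Fin n)) 1) :=
  (volume : Measure (EuclideanSpace ℝ (Fin n))).toSphere

/-- `K` is a convex body: compact, convex, with nonempty interior. -/
def IsConvexBody {n : ℕ} (K : Set (EuclideanSpace ℝ (Fin n))) : Prop :=
  IsCompact K ∧ Convex ℝ K ∧ (interior K).Nonempty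

/-- The support function of `K`: `s_K(u) = max_{x ∈ K} x·u`. -/
def supp {n : ℕ} (K : Set (EuclideanSpace ℝ (Fin n))) (u : EuclideanSpace ℝ (Fin n)) : ℝ :=
  sSup ((fun x => ⟪x, u⟫) '' K)

/-- `n`-dimensional Lebesgue measure (volume), as a real number. -/
def vol {n : ℕ} (K : Set (EuclideanSpace ℝ (Fin n))) : ℝ :=
  (volume K).toReal

/-- The closed unit ball `B` of `ℝⁿ`. -/
def unitBall (n : ℕ) : Set (EuclideanSpace ℝ (Fin n)) :=
  Metric.closedBall 0 1

/-- The entropy functional `𝓔(K) = sup_{x ∈ int K} ∫_{S^{n-1}} log (s_K(u) - x·u) dθ`. -/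
def entropy {n : ℕ} (K : Set (EuclideanSpace ℝ (Fin n))) : ℝ :=
  sSup ((fun x => ∫ u, Real.log (supp K u - ⟪x, (u : EuclideanSpace ℝ (Fin n))⟫)
      ∂(sphMeasure n)) '' interior K)

/-- The `p`-entropy functional `𝓔_p(K) = inf_{x ∈ int K} ∫_{S^{n-1}} (s_K(u) - x·u)^p dθ`. -/
def entropyP {n : ℕ} (p : ℝ) (K : Set (EuclideanSpace ℝ (Fin n))) : ℝ :=
  sInf ((fun x => ∫ u, (supp K u - ⟪x, (u : EuclideanSpace ℝ (Fin n))⟫) ^ p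
      ∂(sphMeasure n)) '' interior K)

/-- The Hausdorff distance between convex bodies,
`δ_H(K,L) = sup_{u ∈ S^{n-1}} |s_K(u) - s_L(u)|`. -/
def hdist {n : ℕ} (K L : Set (EuclideanSpace ℝ (Fin n))) : ℝ :=
  ⨆ u : Metric.sphere (0 : EuclideanSpace ℝ (Fin n)) 1, |supp K u - supp L u|

/-- The beta integral `β(a,b) = ∫₀¹ t^(a-1) (1-t)^(b-1) dt`. -/
def betaInt (a b : ℝ) : ℝ :=
  ∫ t in (0:ℝ)..1, t ^ (a - 1) * (1 - t) ^ (b - 1)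

/-- The constant `α_n = n V(B) β(3, n-1) / β(1/2, (n-1)/2)` from Vitale's lemma. -/
def alphaConst (n : ℕ) : ℝ :=
  n * vol (unitBall n) * betaInt 3 ((n : ℝ) - 1) / betaInt (1/2) (((n : ℝ) - 1) / 2)

/-- The radius `r = (∫_{S^{n-1}} dθ)^{1/2} / (∫_{S^{n-1}} (s_K(u) - e·u)^{-2} dθ)^{1/2}`. -/
def rConst {n : ℕ} (K : Set (EuclideanSpace ℝ (Fin n))) (e : EuclideanSpace ℝ (Fin n)) : ℝ :=
  ((sphMeasure n) Set.univ).toReal ^ ((1 : ℝ) / 2) /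
    (∫ u, (supp K u - ⟪e, (u : EuclideanSpace ℝ (Fin n))⟫) ^ (-2 : ℝ) ∂(sphMeasure n))
      ^ ((1 : ℝ) / 2)

lemma vol_midpoint {A B C : Set ℝ} (hA : A.Nonempty) (hB : B.Nonempty) (hC : C.OrdConnected)
    (h : ∀ a ∈ A, ∀ b ∈ B, (a + b) / 2 ∈ C) :
    volume A + volume B ≤ 2 * volume C := by
  have key : ∀ a1 ∈ A, ∀ a2 ∈ A, ∀ b1 ∈ B, ∀ b2 ∈ B,
      edist a1 a2 + edist b1 b2 ≤ 2 * volume C := by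
    have aux : ∀ a1 ∈ A, ∀ a2 ∈ A, ∀ b1 ∈ B, ∀ b2 ∈ B, a1 ≤ a2 → b1 ≤ b2 →
      edist a1 a2 + edist b1 b2 ≤ 2 * volume C := by
      intro a1 h1 a2 h2 b1 h3 b2 h4 h5 h6
      have hsub : Icc ((a1+b1)/2) ((a2+b2)/2) ⊆ C := hC.out (h _ h1 _ h3) (h _ h2 _ h4)
      have := measure_mono (μ := volume) hsub
      rw [Real.volume_Icc] at this
      calc edist a1 a2 + edist b1 b2 = 2 * ENNReal.ofReal ((a2+b2)/2 - (a1+b1)/2) := by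
            rw [edist_dist, edist_dist, ← ENNReal.ofReal_add dist_nonneg dist_nonneg,
              show (2:ENNReal) = ENNReal.ofReal 2 by simp, ← ENNReal.ofReal_mul (by norm_num),
              Real.dist_eq, Real.dist_eq, abs_of_nonpos (by linarith), abs_of_nonpos (by linarith)]
            congr 1; ring
        _ ≤ _ := by gcongr
    intro a1 h1 a2 h2 b1 h3 b2 h4
    rcases le_total a1 a2 with h5 | h5 <;> rcases le_total b1 b2 with h6 | h6
    · exact aux a1 h1 a2 h2 b1 h3 b2 h4 h5 h6
    · rw [edist_comm b1]; exact aux a1 h1 a2 h2 b2 h4 b1 h3 h5 h6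
    · rw [edist_comm a1]; exact aux a2 h2 a1 h1 b1 h3 b2 h4 h5 h6
    · rw [edist_comm a1, edist_comm b1]; exact aux a2 h2 a1 h1 b2 h4 b1 h3 h5 h6
  refine (add_le_add (Real.volume_le_diam A) (Real.volume_le_diam B)).trans ?_
  by_cases hT : 2 * volume C = ⊤
  · rw [hT]; exact le_top
  obtain ⟨a0, ha0⟩ := hA
  obtain ⟨b0, hb0⟩ := hB
  have s1 : ∀ a1 ∈ A, ∀ a2 ∈ A, edist a1 a2 + ediam B ≤ 2 * volume C := by
    intro a1 h1 a2 h2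
    have h3 : ediam B ≤ 2 * volume C - edist a1 a2 := by
      apply ediam_le
      intro b1 h3 b2 h4
      exact ENNReal.le_sub_of_add_le_left (edist_ne_top _ _) (key _ h1 _ h2 _ h3 _ h4)
    have h4 : edist a1 a2 ≤ 2 * volume C := by
      have := key _ h1 _ h2 _ hb0 _ hb0
      simpa using this
    calc edist a1 a2 + ediam B ≤ edist a1 a2 + (2 * volume C - edist a1 a2) := by gcongr
      _ = _ := add_tsub_cancel_of_le h4
  have hBf : ediam B ≤ 2 * volume C := by simpa using s1 _ ha0 _ ha0
  have : ediam A ≤ 2 * volume C - ediam B := by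
    apply ediam_le
    intro a1 h1 a2 h2
    exact ENNReal.le_sub_of_add_le_right (ne_top_of_le_ne_top hT hBf) (s1 _ h1 _ h2)
  calc _ ≤ (2 * volume C - ediam B) + ediam B := by gcongr
    _ = _ := tsub_add_cancel_of_le hBf

lemma pl_normalized {α β h : ℝ → ℝ} (hα : Measurable α) (hβ : Measurable β) (hh : Measurable h)
    (hα0 : ∀ x, 0 ≤ α x) (hβ0 : ∀ x, 0 ≤ β x) (hh0 : ∀ x, 0 ≤ h x)
    (hα1 : ∀ x, α x ≤ 1) (hβ1 : ∀ x, β x ≤ 1)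
    (hαs : ∀ t < 1, ∃ x, t < α x) (hβs : ∀ t < 1, ∃ x, t < β x)
    (hoc : ∀ t, (0:ℝ) < t → {x | t < h x}.OrdConnected)
    (H : ∀ t, 0 < t → ∀ u v, t < α u → t < β v → t < h ((u + v) / 2)) :
    (∫⁻ x, ENNReal.ofReal (α x)) + (∫⁻ x, ENNReal.ofReal (β x))
      ≤ 2 * ∫⁻ x, ENNReal.ofReal (h x) := by
  rw [lintegral_eq_lintegral_meas_lt volume (ae_of_all _ hα0) hα.aemeasurable,
    lintegral_eq_lintegral_meas_lt volume (ae_of_all _ hβ0) hβ.aemeasurable,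
    lintegral_eq_lintegral_meas_lt volume (ae_of_all _ hh0) hh.aemeasurable,
    ← lintegral_add_left, ← lintegral_const_mul]
  · apply setLIntegral_mono' measurableSet_Ioi
    intro t ht
    have ht : 0 < t := ht
    rcases lt_or_ge t 1 with h1 | h1
    · exact vol_midpoint (hαs t h1) (hβs t h1) (hoc t ht) (fun a ha b hb => H t ht a b ha hb)
    · have e1 : {a | t < α a} = ∅ := by
        ext x; simp; exact (hα1 x).trans h1
      have e2 : {a | t < β a} = ∅ := by
        ext x; simp; exact (hβ1 x).trans h1
      rw [e1, e2]; simp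
  · have : Antitone (fun t => volume {a | t < h a}) := fun s t hst => measure_mono
      fun x hx => lt_of_le_of_lt hst hx
    exact this.measurable
  · have : Antitone (fun t => volume {a | t < α a}) := fun s t hst => measure_mono
      fun x hx => lt_of_le_of_lt hst hx
    exact this.measurable

lemma pl_one {α β h : ℝ → ℝ} (hα : Measurable α) (hβ : Measurable β) (hh : Measurable h)
    (hα0 : ∀ x, 0 ≤ α x) (hβ0 : ∀ x, 0 ≤ β x) (hh0 : ∀ x, 0 ≤ h x)
    {M : ℝ} (hα1 : ∀ x, α x ≤ M) (hβ1 : ∀ x, β x ≤ M)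
    (hintA : Integrable h)
    (hoc : ∀ t, (0:ℝ) < t → {x | t < h x}.OrdConnected)
    (H : ∀ u v, α u * β v ≤ (h ((u + v) / 2)) ^ 2) :
    Integrable α ∧ Integrable β ∧ (∫ x, α x) * (∫ x, β x) ≤ (∫ x, h x) ^ 2 ∨
      (∫ x, α x) = 0 ∨ (∫ x, β x) = 0 := by
  by_cases h1 : ∃ u, 0 < α u
  swap
  · right; left
    push Not at h1
    have : α = 0 := by ext u; exact le_antisymm (h1 u) (hα0 u)
    simp [this]
  by_cases h2 : ∃ u, 0 < β u
  swap
  · right; right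
    push Not at h2
    have : β = 0 := by ext u; exact le_antisymm (h2 u) (hβ0 u)
    simp [this]
  left
  obtain ⟨u1, hu1⟩ := h1
  obtain ⟨u2, hu2⟩ := h2
  have bα : BddAbove (range α) := ⟨M, by rintro _ ⟨x, rfl⟩; exact hα1 x⟩
  have bβ : BddAbove (range β) := ⟨M, by rintro _ ⟨x, rfl⟩; exact hβ1 x⟩
  set p := ⨆ x, α x
  set q := ⨆ x, β x
  have hαp : ∀ x, α x ≤ p := le_ciSup bα
  have hβq : ∀ x, β x ≤ q := le_ciSup bβ
  have hp : 0 < p := hu1.trans_le (hαp u1)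
  have hq : 0 < q := hu2.trans_le (hβq u2)
  have hs : 0 < √(p * q) := Real.sqrt_pos.2 (mul_pos hp hq)
  have hs2 : √(p * q) ^ 2 = p * q := Real.sq_sqrt (mul_pos hp hq).le
  have N := pl_normalized (α := fun x => α x / p) (β := fun x => β x / q)
    (h := fun x => h x / √(p * q)) (hα.div_const _) (hβ.div_const _) (hh.div_const _)
    (fun x => div_nonneg (hα0 x) hp.le) (fun x => div_nonneg (hβ0 x) hq.le)
    (fun x => div_nonneg (hh0 x) hs.le)
    (fun x => (div_le_one hp).2 (hαp x)) (fun x => (div_le_one hq).2 (hβq x))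
    (fun t ht => by
      obtain ⟨x, hx⟩ := exists_lt_of_lt_ciSup (show t * p < p by nlinarith)
      exact ⟨x, (lt_div_iff₀ hp).2 hx⟩)
    (fun t ht => by
      obtain ⟨x, hx⟩ := exists_lt_of_lt_ciSup (show t * q < q by nlinarith)
      exact ⟨x, (lt_div_iff₀ hq).2 hx⟩)
    (fun t ht => by
      have := hoc (t * √(p*q)) (mul_pos ht hs)
      convert this using 3
      rw [lt_div_iff₀ hs])
    (fun t ht u v h1 h2 => by
      rw [lt_div_iff₀ hp] at h1
      rw [lt_div_iff₀ hq] at h2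
      rw [lt_div_iff₀ hs]
      have h3 := H u v
      apply lt_of_pow_lt_pow_left₀ 2 (hh0 _)
      rw [mul_pow, hs2]
      refine lt_of_lt_of_le ?_ h3
      calc t ^ 2 * (p * q) = (t * p) * (t * q) := by ring
        _ < _ := by
          apply mul_lt_mul'' h1 h2 <;> positivity)
  have iH : Integrable (fun x => h x / √(p * q)) := hintA.div_const _
  have fin : ∫⁻ x, ENNReal.ofReal (h x / √(p * q)) < ⊤ := by
    exact iH.lintegral_lt_top
  have fin2 : 2 * ∫⁻ x, ENNReal.ofReal (h x / √(p * q)) < ⊤ := ENNReal.mul_lt_top (by simp) fin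
  have iα : Integrable (fun x => α x / p) := by
    refine (lintegral_ofReal_ne_top_iff_integrable (hα.div_const _).aestronglyMeasurable
      (ae_of_all _ fun x => div_nonneg (hα0 x) hp.le)).1 ?_
    exact ne_top_of_le_ne_top fin2.ne (le_self_add.trans N)
  have iβ : Integrable (fun x => β x / q) := by
    refine (lintegral_ofReal_ne_top_iff_integrable (hβ.div_const _).aestronglyMeasurable
      (ae_of_all _ fun x => div_nonneg (hβ0 x) hq.le)).1 ?_
    exact ne_top_of_le_ne_top fin2.ne (le_add_self.trans N)
  have N' : (∫ x, α x / p) + (∫ x, β x / q) ≤ 2 * ∫ x, h x / √(p * q) := by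
    rw [← ofReal_integral_eq_lintegral_ofReal iα (ae_of_all _ fun x => div_nonneg (hα0 x) hp.le),
      ← ofReal_integral_eq_lintegral_ofReal iβ (ae_of_all _ fun x => div_nonneg (hβ0 x) hq.le),
      ← ofReal_integral_eq_lintegral_ofReal iH (ae_of_all _ fun x => div_nonneg (hh0 x) hs.le),
      ← ENNReal.ofReal_add, show (2:ENNReal) = ENNReal.ofReal 2 by simp,
      ← ENNReal.ofReal_mul (by norm_num)] at N
    · refine (ENNReal.ofReal_le_ofReal_iff ?_).1 N
      have : 0 ≤ ∫ x, h x / √(p * q) := integral_nonneg fun x => div_nonneg (hh0 x) hs.le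
      positivity
    · exact integral_nonneg fun x => div_nonneg (hα0 x) hp.le
    · exact integral_nonneg fun x => div_nonneg (hβ0 x) hq.le
  refine ⟨?_, ?_, ?_⟩
  · have := iα.mul_const p
    convert this using 2 with x
    field_simp
  · have := iβ.mul_const q
    convert this using 2 with x
    field_simp
  rw [integral_div, integral_div, integral_div] at N'
  set a := ∫ x, α x
  set b := ∫ x, β x
  set c := ∫ x, h x
  have ha : 0 ≤ a := integral_nonneg hα0
  have hb : 0 ≤ b := integral_nonneg hβ0
  have hc : 0 ≤ c := integral_nonneg hh0
  have h4 : 4 * ((a / p) * (b / q)) ≤ 4 * (c / √(p*q)) ^ 2 := by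
    have h0 : 0 ≤ a / p + b / q := by positivity
    nlinarith [sq_nonneg (a / p - b / q), pow_le_pow_left₀ h0 N' 2]
  rw [div_pow, hs2, div_mul_div_comm] at h4
  have h5 : a * b / (p * q) ≤ c ^ 2 / (p * q) := by linarith
  exact (div_le_div_iff_of_pos_right (mul_pos hp hq)).1 h5

lemma integral_exp_subst (a : ℝ → ℝ) :
    ∫ u, a (rexp u) * rexp u = ∫ s in Ioi 0, a s := by
  have := integral_image_eq_integral_abs_deriv_smul (s := univ) (f := rexp) (f' := rexp)
    MeasurableSet.univ (fun x _ => (Real.hasDerivAt_exp x).hasDerivWithinAt)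
    (Real.exp_injective.injOn) a
  rw [image_univ, Real.range_exp] at this
  rw [this]
  simp [abs_of_pos (Real.exp_pos _), mul_comm]

lemma integrable_exp_subst (a : ℝ → ℝ) :
    Integrable (fun u => a (rexp u) * rexp u) ↔ IntegrableOn a (Ioi 0) := by
  have := integrableOn_image_iff_integrableOn_abs_deriv_smul (s := univ) (f := rexp) (f' := rexp)
    MeasurableSet.univ (fun x _ => (Real.hasDerivAt_exp x).hasDerivWithinAt)
    (Real.exp_injective.injOn) a
  rw [image_univ, Real.range_exp] at this
  rw [this]
  simp [abs_of_pos (Real.exp_pos _), mul_comm]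

/-- One-dimensional Santalo type inequality on the half line. -/
lemma santalo_half_line {a b : ℝ → ℝ} (ha : Measurable a) (hb : Measurable b)
    (ha0 : ∀ x, 0 ≤ a x) (hb0 : ∀ x, 0 ≤ b x)
    {M R : ℝ} (haM : ∀ x, a x ≤ M) (hbM : ∀ x, b x ≤ M)
    (haR : ∀ x, a x ≠ 0 → |x| ≤ R) (hbR : ∀ x, b x ≠ 0 → |x| ≤ R)
    {C : ℝ} (hC : 0 ≤ C)
    (H : ∀ s t, 0 < s → 0 < t → a s * b t ≤ C * rexp (-(s * t))) :
    (∫ s in Ioi 0, a s) * (∫ t in Ioi 0, b t) ≤ C * (π / 2) := by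
  have hM : 0 ≤ M := (ha0 0).trans (haM 0)
  have hRHS : 0 ≤ C * (π / 2) := by positivity
  let h : ℝ → ℝ := fun w => √C * (rexp (-(1/2) * (rexp w) ^ 2) * rexp w)
  have hg : IntegrableOn (fun s : ℝ => rexp (-(1/2) * s ^ 2)) (Ioi 0) :=
    (integrable_exp_neg_mul_sq (by norm_num : (0:ℝ) < 1/2)).integrableOn
  have hintA : Integrable h :=
    ((integrable_exp_subst (fun s => rexp (-(1/2) * s ^ 2))).2 hg).const_mul _
  have hval : ∫ w, h w = √C * (√(2 * π) / 2) := by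
    simp only [h]
    rw [integral_const_mul, integral_exp_subst (fun s => rexp (-(1/2) * s ^ 2)),
      integral_gaussian_Ioi]
    congr 3
    ring
  have bd : ∀ (f : ℝ → ℝ), (∀ x, 0 ≤ f x) → (∀ x, f x ≤ M) → (∀ x, f x ≠ 0 → |x| ≤ R) →
      ∀ u, f (rexp u) * rexp u ≤ M * |R| := by
    intro f h0 h1 h2 u
    by_cases hz : f (rexp u) = 0
    · rw [hz]; simp; positivity
    · have h3 := h2 _ hz
      rw [abs_of_pos (Real.exp_pos _)] at h3
      exact mul_le_mul (h1 _) (h3.trans (le_abs_self _)) (Real.exp_pos _).le hM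
  have := pl_one (α := fun u => a (rexp u) * rexp u) (β := fun u => b (rexp u) * rexp u) (h := h)
    (by fun_prop) (by fun_prop) (by fun_prop)
    (fun x => mul_nonneg (ha0 _) (Real.exp_pos _).le)
    (fun x => mul_nonneg (hb0 _) (Real.exp_pos _).le)
    (fun x => by positivity) (bd a ha0 haM haR) (bd b hb0 hbM hbR) hintA
    (by
      intro t ht
      rcases hC.eq_or_lt with h0 | h0
      · have : {x | t < h x} = ∅ := by
          ext x; simp [h, ← h0]; exact ht.le
        rw [this]; exact ordConnected_empty
      have hconc : ConcaveOn ℝ univ (fun w : ℝ => w - rexp (2 * w) / 2) := by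
        apply (concaveOn_id convex_univ).sub
        have h1 : ConvexOn ℝ univ (fun w : ℝ => rexp (2 * w)) := by
          have := convexOn_exp.comp_linearMap (LinearMap.lsmul ℝ ℝ (2:ℝ))
          simpa [Function.comp_def] using this
        have := h1.smul (by norm_num : (0:ℝ) ≤ 1/2)
        simpa [div_eq_inv_mul] using this
      have hset : {x | t < h x} = {x ∈ univ | Real.log (t / √C) < x - rexp (2 * x) / 2} := by
        have hc : 0 < √C := Real.sqrt_pos.2 h0
        ext x
        simp only [mem_setOf_eq, mem_univ, true_and, h]
        rw [Real.log_lt_iff_lt_exp (by positivity), div_lt_iff₀ hc, mul_comm, ← Real.exp_add,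
          ← Real.exp_nat_mul]
        have : -(1 / 2) * rexp ((2:ℕ) * x) + x = x - rexp (2 * x) / 2 := by push_cast; ring
        rw [this, mul_comm]
      rw [hset]
      exact (hconc.convex_gt _).ordConnected)
    (by
      intro u v
      have h1 := H _ _ (Real.exp_pos u) (Real.exp_pos v)
      have e1 : (h ((u+v)/2)) ^ 2 = C * rexp (-(rexp u * rexp v)) * (rexp u * rexp v) := by
        simp only [h]
        rw [mul_pow, Real.sq_sqrt hC, ← Real.exp_add, ← Real.exp_nat_mul, ← Real.exp_nat_mul,
          ← Real.exp_add, mul_assoc, ← Real.exp_add]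
        congr 2
        push_cast
        rw [show 2 * ((u + v) / 2) = u + v by ring]
        ring
      rw [e1]
      calc _ = (a (rexp u) * b (rexp v)) * (rexp u * rexp v) := by ring
        _ ≤ _ := by gcongr)
  rw [integral_exp_subst, integral_exp_subst, hval] at this
  rcases this with ⟨-, -, h1⟩ | h1 | h1
  · refine h1.trans (le_of_eq ?_)
    rw [mul_pow, div_pow, Real.sq_sqrt hC, Real.sq_sqrt (by positivity)]
    ring
  · rw [h1]; simpa using hRHS
  · rw [h1]; simpa using hRHS

/-- Bounded measurable nonnegative functions with bounded support. -/
structure NiceFn {X : Type*} [NormedAddCommGroup X] [MeasurableSpace X] (f : X → ℝ) : Prop where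
  meas : Measurable f
  nonneg : ∀ x, 0 ≤ f x
  bdd : ∃ C, ∀ x, f x ≤ C
  supp : ∃ R, ∀ x, f x ≠ 0 → ‖x‖ ≤ R

lemma NiceFn.integrable_mul {X : Type*} [NormedAddCommGroup X] [MeasurableSpace X]
    [BorelSpace X] [ProperSpace X] {f : X → ℝ} (hf : NiceFn f) {k : X → ℝ} (hk : Continuous k)
    (μ : Measure X) [IsFiniteMeasureOnCompacts μ] :
    Integrable (fun x => k x * f x) μ := by
  obtain ⟨C, hC⟩ := hf.bdd
  obtain ⟨R, hR⟩ := hf.supp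
  have hcomp : IsCompact (closedBall (0:X) R) := isCompact_closedBall 0 R
  obtain ⟨D, hD⟩ := hcomp.exists_bound_of_continuousOn hk.continuousOn
  have h1 : IntegrableOn (fun x => k x * f x) (closedBall (0:X) R) μ := by
    refine Measure.integrableOn_of_bounded (M := D * C) hcomp.measure_lt_top.ne
      (hk.measurable.mul hf.meas).aestronglyMeasurable ?_
    filter_upwards [ae_restrict_mem hcomp.measurableSet] with x hx
    rw [norm_mul]
    refine mul_le_mul (hD x hx) ?_ (norm_nonneg _) ((norm_nonneg _).trans (hD x hx))
    rw [Real.norm_of_nonneg (hf.nonneg x)]; exact hC x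
  refine (integrableOn_iff_integrable_of_support_subset ?_).1 h1
  intro x hx
  have : f x ≠ 0 := by
    intro h; apply hx; simp [h]
  simpa using hR x this

lemma NiceFn.integrable {X : Type*} [NormedAddCommGroup X] [MeasurableSpace X]
    [BorelSpace X] [ProperSpace X] {f : X → ℝ} (hf : NiceFn f)
    (μ : Measure X) [IsFiniteMeasureOnCompacts μ] :
    Integrable f μ := by
  simpa using hf.integrable_mul continuous_const (k := fun _ => 1) μ

/-- multiply by a positive continuous function -/
lemma NiceFn.mul_cont {X : Type*} [NormedAddCommGroup X] [MeasurableSpace X]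
    [BorelSpace X] [ProperSpace X] {f : X → ℝ} (hf : NiceFn f) {k : X → ℝ} (hk : Continuous k)
    (hk0 : ∀ x, 0 ≤ k x) : NiceFn (fun x => k x * f x) := by
  obtain ⟨C, hC⟩ := hf.bdd
  obtain ⟨R, hR⟩ := hf.supp
  have hcomp : IsCompact (closedBall (0:X) R) := isCompact_closedBall 0 R
  obtain ⟨D, hD⟩ := hcomp.exists_bound_of_continuousOn hk.continuousOn
  refine ⟨hk.measurable.mul hf.meas, fun x => mul_nonneg (hk0 x) (hf.nonneg x), ⟨|D| * |C|, ?_⟩,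
    ⟨R, fun x hx => hR x (by intro h; apply hx; simp [h])⟩⟩
  intro x
  by_cases h : f x = 0
  · rw [h]; simp; positivity
  · have h2 := hD x (by simpa using hR x h)
    refine mul_le_mul ?_ ((hC x).trans (le_abs_self _)) (hf.nonneg x) (abs_nonneg _)
    exact (le_abs_self _).trans (h2.trans (le_abs_self _))

/-- compose with a homeomorphism whose inverse is continuous -/
lemma NiceFn.comp_cont {X : Type*} [NormedAddCommGroup X] [MeasurableSpace X]
    [BorelSpace X] [ProperSpace X] {f : X → ℝ} (hf : NiceFn f) {k l : X → X} (hk : Continuous k)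
    (hl : Continuous l) (hlk : ∀ x, l (k x) = x) : NiceFn (fun x => f (k x)) := by
  obtain ⟨C, hC⟩ := hf.bdd
  obtain ⟨R, hR⟩ := hf.supp
  have hcomp : IsCompact (closedBall (0:X) R) := isCompact_closedBall 0 R
  obtain ⟨D, hD⟩ := hcomp.exists_bound_of_continuousOn hl.continuousOn
  refine ⟨hf.meas.comp hk.measurable, fun x => hf.nonneg _, ⟨C, fun x => hC _⟩, ⟨D, fun x hx => ?_⟩⟩
  have := hD (k x) (by simpa using hR _ hx)
  rwa [hlk] at this

lemma NiceFn.half {n : ℕ} {f : ℝ × (Fin n → ℝ) → ℝ} (hf : NiceFn f) :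
    NiceFn (fun x : Fin n → ℝ => ∫ s in Ioi 0, f (s, x)) := by
  obtain ⟨C, hC⟩ := hf.bdd
  obtain ⟨R, hR⟩ := hf.supp
  refine ⟨?_, fun x => integral_nonneg fun s => hf.nonneg _, ⟨C * (2 * |R|), fun x => ?_⟩,
    ⟨R, fun x hx => ?_⟩⟩
  · have := (hf.meas.stronglyMeasurable).integral_prod_left' (μ := volume.restrict (Ioi (0:ℝ)))
    exact this.measurable
  · have hC0 : 0 ≤ C := (hf.nonneg (0, x)).trans (hC _)
    have h1 : ∀ s, f (s, x) ≤ (Icc (-|R|) |R|).indicator (fun _ => C) s := by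
      intro s
      by_cases hs : f (s, x) = 0
      · rw [hs]; exact indicator_nonneg (fun _ _ => hC0) _
      · have h2 := hR _ hs
        have h3 : |s| ≤ R := (norm_fst_le (s, x)).trans h2
        rw [indicator_of_mem]
        · exact hC _
        · exact abs_le.1 (h3.trans (le_abs_self _))
    have hii : Integrable ((Icc (-|R|) |R|).indicator (fun _ : ℝ => C)) := by
      refine (integrable_indicator_iff measurableSet_Icc).2 ?_
      exact integrableOn_const (by simp) 
    calc ∫ s in Ioi 0, f (s, x) ≤ ∫ s in Ioi 0, (Icc (-|R|) |R|).indicator (fun _ => C) s := by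
          apply integral_mono_of_nonneg (ae_of_all _ fun s => hf.nonneg _) hii.integrableOn
            (ae_of_all _ h1)
      _ ≤ ∫ s, (Icc (-|R|) |R|).indicator (fun _ => C) s := by
          apply setIntegral_le_integral hii
          exact ae_of_all _ fun s => indicator_nonneg (fun _ _ => hC0) _
      _ = C * (2 * |R|) := by
          rw [integral_indicator measurableSet_Icc, setIntegral_const]
          simp [Measure.real, ENNReal.toReal_ofReal]
          ring
  · by_contra hcon
    apply hx
    have : ∀ s, f (s, x) = 0 := by
      intro s
      by_contra h
      exact hcon ((norm_snd_le (s, x)).trans (hR _ h))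
    simp [this]

/-- The functional Santalo statement in dimension `n`. -/
def SantaloFn (n : ℕ) : Prop :=
  ∀ f g : (Fin n → ℝ) → ℝ, NiceFn f → NiceFn g →
    (∀ x y, f x * g y ≤ rexp (-(dotProduct x y))) →
    (∀ i, ∫ x, x i * f x = 0) → (∫ x, f x) * (∫ x, g x) ≤ (2 * π) ^ n

lemma NiceFn.sect {n : ℕ} {f : ℝ × (Fin n → ℝ) → ℝ} (hf : NiceFn f) (x : Fin n → ℝ) :
    NiceFn (fun s : ℝ => f (s, x)) := by
  obtain ⟨C, hC⟩ := hf.bdd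
  obtain ⟨R, hR⟩ := hf.supp
  exact ⟨hf.meas.comp (by fun_prop), fun s => hf.nonneg _, ⟨C, fun s => hC _⟩,
    ⟨R, fun s hs => (norm_fst_le (s, x)).trans (hR _ hs)⟩⟩

lemma NiceFn.const_mul {X : Type*} [NormedAddCommGroup X] [MeasurableSpace X]
    {f : X → ℝ} (hf : NiceFn f) {c : ℝ} (hc : 0 ≤ c) : NiceFn (fun x => c * f x) := by
  obtain ⟨C, hC⟩ := hf.bdd
  obtain ⟨R, hR⟩ := hf.supp
  exact ⟨hf.meas.const_mul _, fun x => mul_nonneg hc (hf.nonneg x),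
    ⟨c * C, fun x => mul_le_mul_of_nonneg_left (hC x) hc⟩,
    ⟨R, fun x hx => hR x (by intro h; apply hx; simp [h])⟩⟩

lemma half_integral_comm {n : ℕ} {f : ℝ × (Fin n → ℝ) → ℝ} (hf : NiceFn f)
    {k : (Fin n → ℝ) → ℝ} (hk : Continuous k) :
    ∫ x, k x * (∫ s in Ioi 0, f (s, x)) = ∫ p in (Ioi (0:ℝ)) ×ˢ univ, k p.2 * f p := by
  have h1 : Integrable (fun p : ℝ × (Fin n → ℝ) => k p.2 * f p) :=
    hf.integrable_mul (hk.comp continuous_snd) volume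
  rw [Measure.volume_eq_prod, ← Measure.prod_restrict, Measure.restrict_univ, integral_prod_symm]
  · simp only [integral_const_mul]
  · have := h1.integrableOn (s := (Ioi (0:ℝ)) ×ˢ univ)
    rw [IntegrableOn, Measure.volume_eq_prod, ← Measure.prod_restrict, Measure.restrict_univ] at this
    exact this

lemma santalo_half {n : ℕ} (IH : SantaloFn n) {f g : ℝ × (Fin n → ℝ) → ℝ}
    (hf : NiceFn f) (hg : NiceFn g)
    (H : ∀ p q : ℝ × (Fin n → ℝ), f p * g q ≤ rexp (-(p.1 * q.1 + dotProduct p.2 q.2)))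
    (hb : ∀ i, ∫ p in (Ioi (0:ℝ)) ×ˢ (univ : Set (Fin n → ℝ)), p.2 i * f p = 0) :
    (∫ p in (Ioi (0:ℝ)) ×ˢ univ, f p) * (∫ p in (Ioi (0:ℝ)) ×ˢ univ, g p)
      ≤ (2 * π) ^ n * (π / 2) := by
  have hpt : ∀ x y : Fin n → ℝ, (∫ s in Ioi 0, f (s, x)) * (2 / π * ∫ s in Ioi 0, g (s, y)) ≤
      rexp (-(dotProduct x y)) := by
    intro x y
    obtain ⟨C, hC⟩ := hf.bdd
    obtain ⟨R, hR⟩ := (hf.sect x).supp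
    obtain ⟨C', hC'⟩ := hg.bdd
    obtain ⟨R', hR'⟩ := (hg.sect y).supp
    have := santalo_half_line (a := fun s => f (s, x)) (b := fun s => g (s, y))
      (M := max C C') (R := max R R') (C := rexp (-(dotProduct x y)))
      (hf.sect x).meas (hg.sect y).meas (hf.sect x).nonneg (hg.sect y).nonneg
      (fun s => (hC _).trans (le_max_left _ _)) (fun s => (hC' _).trans (le_max_right _ _))
      (fun s hs => (hR s hs).trans (le_max_left _ _))
      (fun s hs => (hR' s hs).trans (le_max_right _ _)) (Real.exp_pos _).le
      (fun s t _ _ => by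
        have := H (s, x) (t, y)
        simp only at this
        refine this.trans (le_of_eq ?_)
        rw [← Real.exp_add]; ring_nf)
    have hpi := Real.pi_pos
    calc _ = 2 / π * ((∫ s in Ioi 0, f (s, x)) * (∫ s in Ioi 0, g (s, y))) := by ring
      _ ≤ 2 / π * (rexp (-(dotProduct x y)) * (π / 2)) := by gcongr
      _ = _ := by field_simp
  have := IH _ _ hf.half (hg.half.const_mul (by positivity : (0:ℝ) ≤ 2 / π)) hpt
    (fun i => by
      rw [half_integral_comm hf (k := fun x => x i) (continuous_apply i)]
      exact hb i)
  rw [integral_const_mul] at this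
  have e1 := half_integral_comm hf (k := fun x => 1) continuous_const
  have e2 := half_integral_comm hg (k := fun x => 1) continuous_const
  simp only [one_mul] at e1 e2
  rw [e1, e2] at this
  have hpi := Real.pi_pos
  calc _ = π / 2 * ((∫ p in (Ioi (0:ℝ)) ×ˢ univ, f p) *
        (2 / π * ∫ p in (Ioi (0:ℝ)) ×ˢ univ, g p)) := by field_simp
    _ ≤ π / 2 * (2 * π) ^ n := by gcongr
    _ = _ := by ring

lemma integral_reflect {n : ℕ} (f : ℝ × (Fin n → ℝ) → ℝ) :
    ∫ p in (Ioi (0:ℝ)) ×ˢ univ, f (-p.1, p.2) = ∫ p in (Iio (0:ℝ)) ×ˢ univ, f p := by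
  let e : ℝ × (Fin n → ℝ) ≃ᵐ ℝ × (Fin n → ℝ) :=
    (MeasurableEquiv.neg ℝ).prodCongr (MeasurableEquiv.refl _)
  have he : MeasurePreserving e volume volume := by
    have h1 : MeasurePreserving (fun x : ℝ => -x) volume volume := Measure.measurePreserving_neg _
    exact h1.prod (MeasurePreserving.id (volume : Measure (Fin n → ℝ)))
  have := he.setIntegral_preimage_emb e.measurableEmbedding f ((Iio (0:ℝ)) ×ˢ univ)
  rw [← this]
  have hset : e ⁻¹' ((Iio (0:ℝ)) ×ˢ univ) = (Ioi (0:ℝ)) ×ˢ univ := by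
    ext p
    simp only [mem_preimage, mem_prod, mem_univ, and_true, mem_Iio, mem_Ioi]
    exact neg_lt_zero
  rw [hset]
  rfl

lemma integral_split {n : ℕ} {f : ℝ × (Fin n → ℝ) → ℝ} (hf : Integrable f) :
    ∫ p, f p = (∫ p in (Ioi (0:ℝ)) ×ˢ univ, f p) + ∫ p in (Iio (0:ℝ)) ×ˢ univ, f p := by
  have h1 : (Iio (0:ℝ)) ×ˢ (univ : Set (Fin n → ℝ)) =ᵐ[volume] (Iic (0:ℝ)) ×ˢ univ := by
    rw [Measure.volume_eq_prod]
    exact Measure.set_prod_ae_eq Iio_ae_eq_Iic (Filter.EventuallyEq.refl _ _)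
  rw [setIntegral_congr_set h1]
  have h2 : (Iic (0:ℝ)) ×ˢ (univ : Set (Fin n → ℝ)) = ((Ioi (0:ℝ)) ×ˢ univ)ᶜ := by
    ext p; simp [mem_prod]
  rw [h2, integral_add_compl (measurableSet_Ioi.prod MeasurableSet.univ) hf]

/-- Balanced case: `f` is bisected by `{t = 0}` and both halves have barycenter on the axis. -/
lemma santalo_balanced {n : ℕ} (IH : SantaloFn n) {f g : ℝ × (Fin n → ℝ) → ℝ}
    (hf : NiceFn f) (hg : NiceFn g)
    (H : ∀ p q : ℝ × (Fin n → ℝ), f p * g q ≤ rexp (-(p.1 * q.1 + dotProduct p.2 q.2)))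
    (hb : ∀ i, ∫ p in (Ioi (0:ℝ)) ×ˢ (univ : Set (Fin n → ℝ)), p.2 i * f p = 0)
    (hb' : ∀ i, ∫ p in (Iio (0:ℝ)) ×ˢ (univ : Set (Fin n → ℝ)), p.2 i * f p = 0)
    (hm : ∫ p in (Ioi (0:ℝ)) ×ˢ univ, f p = ∫ p in (Iio (0:ℝ)) ×ˢ univ, f p) :
    (∫ p, f p) * (∫ p, g p) ≤ (2 * π) ^ (n + 1) := by
  have h1 := santalo_half IH hf hg H hb
  have hcont : Continuous (fun p : ℝ × (Fin n → ℝ) => (-p.1, p.2)) := by fun_prop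
  have hf' : NiceFn (fun p : ℝ × (Fin n → ℝ) => f (-p.1, p.2)) :=
    hf.comp_cont hcont hcont (by simp)
  have hg' : NiceFn (fun p : ℝ × (Fin n → ℝ) => g (-p.1, p.2)) :=
    hg.comp_cont hcont hcont (by simp)
  have h2 := santalo_half IH hf' hg' (fun p q => by simpa using H (-p.1, p.2) (-q.1, q.2))
    (fun i => by
      have := integral_reflect (fun p : ℝ × (Fin n → ℝ) => p.2 i * f p)
      simp only at this
      rw [this]; exact hb' i)
  rw [integral_reflect f, integral_reflect g] at h2
  rw [integral_split (hf.integrable volume), integral_split (hg.integrable volume), ← hm]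
  rw [← hm] at h2
  rw [pow_succ]
  nlinarith

lemma exists_bisect {n : ℕ} {f : ℝ × (Fin n → ℝ) → ℝ} (hf : NiceFn f) :
    ∃ c : ℝ, ∫ p in (Ioi c) ×ˢ univ, f p = (∫ p, f p) / 2 ∧
      ∫ p in (Iio c) ×ˢ univ, f p = (∫ p, f p) / 2 := by
  have hi : Integrable f (volume.prod volume) := hf.integrable volume
  have hφ : Integrable (fun t => ∫ x, f (t, x)) := hi.integral_prod_left
  obtain ⟨R, hR⟩ := hf.supp
  have hz : ∀ t, R < |t| → ∫ x, f (t, x) = 0 := by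
    intro t ht
    have : ∀ x, f (t, x) = 0 := by
      intro x; by_contra h
      exact absurd ((norm_fst_le (t, x)).trans (hR _ h)) (by simpa using ht)
    simp [this]
  have hset : ∀ S : Set ℝ, MeasurableSet S → ∫ p in S ×ˢ univ, f p = ∫ t in S, ∫ x, f (t, x) := by
    intro S hS
    have := hi.integrableOn (s := S ×ˢ univ)
    rw [Measure.volume_eq_prod, setIntegral_prod _ this, Measure.restrict_univ]
  have htot : ∫ p, f p = ∫ t, ∫ x, f (t, x) := by
    rw [Measure.volume_eq_prod, integral_prod _ hi]
  set φ : ℝ → ℝ := fun t => ∫ x, f (t, x) with hφd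
  set Ψ : ℝ → ℝ := fun c => ∫ t in Iic c, φ t with hΨ
  have hcont : Continuous Ψ := by
    have h1 : ∀ c, Ψ c = (∫ t in (0:ℝ)..c, φ t) + Ψ 0 := by
      intro c
      rw [← intervalIntegral.integral_Iic_sub_Iic hφ.integrableOn hφ.integrableOn]
      simp [hΨ]
    rw [funext h1]
    exact (intervalIntegral.continuous_primitive (fun a b => hφ.intervalIntegrable) 0).add_const _
  have hlo : Ψ (-|R| - 1) = 0 := by
    apply setIntegral_eq_zero_of_forall_eq_zero
    intro t ht
    apply hz
    have : t ≤ -|R| - 1 := ht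
    rw [abs_of_nonpos (by linarith [abs_nonneg R])]
    linarith [le_abs_self R]
  have hhi : Ψ (|R| + 1) = ∫ t, φ t := by
    apply setIntegral_eq_integral_of_forall_compl_eq_zero
    intro t ht
    apply hz
    have : |R| + 1 < t := by simpa using ht
    exact (lt_of_le_of_lt (le_abs_self R) (by linarith)).trans_le (le_abs_self t)
  have hφ0 : 0 ≤ ∫ t, φ t := integral_nonneg fun t => integral_nonneg fun x => hf.nonneg _
  obtain ⟨c, -, hc⟩ := intermediate_value_Icc (a := -|R| - 1) (b := |R| + 1)
    (by linarith [abs_nonneg R]) hcont.continuousOn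
    (show (∫ t, φ t) / 2 ∈ Icc (Ψ (-|R| - 1)) (Ψ (|R| + 1)) by
      rw [hlo, hhi]; constructor <;> linarith)
  refine ⟨c, ?_, ?_⟩
  · rw [hset _ measurableSet_Ioi, htot]
    have := integral_add_compl (s := Iic c) measurableSet_Iic hφ
    rw [compl_Iic] at this
    have h2 : ∫ t in Iic c, φ t = (∫ t, φ t) / 2 := hc
    linarith
  · rw [hset _ measurableSet_Iio, htot, setIntegral_congr_set Iio_ae_eq_Iic]
    exact hc

/-- The affine shear used on the first function. -/
def shearA {n : ℕ} (c : ℝ) (a w : Fin n → ℝ) : (ℝ × (Fin n → ℝ)) ≃ₜ (ℝ × (Fin n → ℝ)) where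
  toFun p := (c + p.1, p.2 + (a + p.1 • w))
  invFun p := (p.1 - c, p.2 - (a + (p.1 - c) • w))
  left_inv p := by ext <;> simp
  right_inv p := by ext <;> simp
  continuous_toFun := by fun_prop
  continuous_invFun := by fun_prop

lemma shearA_mp {n : ℕ} (c : ℝ) (a w : Fin n → ℝ) :
    MeasurePreserving (shearA c a w) volume volume := by
  have := MeasurePreserving.skew_product (μa := (volume : Measure ℝ)) (μb := (volume : Measure ℝ))
    (μc := (volume : Measure (Fin n → ℝ))) (μd := (volume : Measure (Fin n → ℝ)))
    (measurePreserving_add_left volume c) (g := fun t y => y + (a + t • w))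
    (by fun_prop) (ae_of_all _ fun t => (measurePreserving_add_right volume (a + t • w)).map_eq)
  exact this

/-- The shear used on the second function. -/
def shearB {n : ℕ} (w : Fin n → ℝ) : (ℝ × (Fin n → ℝ)) ≃ₜ (ℝ × (Fin n → ℝ)) where
  toFun p := (p.1 - dotProduct w p.2, p.2)
  invFun p := (p.1 + dotProduct w p.2, p.2)
  left_inv p := by ext <;> simp
  right_inv p := by ext <;> simp
  continuous_toFun := by unfold dotProduct; fun_prop
  continuous_invFun := by unfold dotProduct; fun_prop

lemma shearB_mp {n : ℕ} (w : Fin n → ℝ) :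
    MeasurePreserving (shearB w) volume volume := by
  have h := MeasurePreserving.skew_product (μc := (volume : Measure ℝ)) (μd := (volume : Measure ℝ))
    (μa := (volume : Measure (Fin n → ℝ))) (μb := (volume : Measure (Fin n → ℝ)))
    (MeasurePreserving.id volume) (g := fun x s => s - dotProduct w x)
    (by unfold dotProduct; fun_prop)
    (ae_of_all _ fun t => (measurePreserving_sub_right volume (dotProduct w t)).map_eq)
  have := (Measure.measurePreserving_swap.comp h).comp Measure.measurePreserving_swap
  exact this

lemma shearA_setIntegral {n : ℕ} (c : ℝ) (a w : Fin n → ℝ) (F : ℝ × (Fin n → ℝ) → ℝ)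
    (S S' : Set ℝ) (hS : ∀ t, t ∈ S ↔ c + t ∈ S') :
    ∫ p in S ×ˢ univ, F (shearA c a w p) = ∫ p in S' ×ˢ univ, F p := by
  rw [← (shearA_mp c a w).setIntegral_preimage_emb (shearA c a w).measurableEmbedding F]
  congr 2
  ext p
  simp [mem_prod, shearA, hS]

lemma santalo_step {n : ℕ} (IH : SantaloFn n) {f g : ℝ × (Fin n → ℝ) → ℝ}
    (hf : NiceFn f) (hg : NiceFn g)
    (H : ∀ p q : ℝ × (Fin n → ℝ), f p * g q ≤ rexp (-(p.1 * q.1 + dotProduct p.2 q.2)))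
    (hb : ∫ p : ℝ × (Fin n → ℝ), p.1 * g p = 0)
    (hb' : ∀ i, ∫ p : ℝ × (Fin n → ℝ), p.2 i * g p = 0) :
    (∫ p, f p) * (∫ p, g p) ≤ (2 * π) ^ (n + 1) := by
  have hf0 : 0 ≤ ∫ p, f p := integral_nonneg hf.nonneg
  rcases hf0.eq_or_lt with h0 | hpos
  · rw [← h0]; simp; positivity
  obtain ⟨c, hc1, hc2⟩ := exists_bisect hf
  set m := (∫ p, f p) / 2 with hm
  have hmpos : 0 < m := by rw [hm]; linarith
  set Np := ∫ p in (Ioi c) ×ˢ (univ : Set (Fin n → ℝ)), (p.1 - c) * f p with hNp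
  set Nm := ∫ p in (Iio c) ×ˢ (univ : Set (Fin n → ℝ)), (p.1 - c) * f p with hNm
  set Mp : Fin n → ℝ := fun i => ∫ p in (Ioi c) ×ˢ (univ : Set (Fin n → ℝ)), p.2 i * f p with hMp
  set Mm : Fin n → ℝ := fun i => ∫ p in (Iio c) ×ˢ (univ : Set (Fin n → ℝ)), p.2 i * f p with hMm
  have msI : MeasurableSet ((Ioi c) ×ˢ (univ : Set (Fin n → ℝ))) :=
    measurableSet_Ioi.prod MeasurableSet.univ
  have msI' : MeasurableSet ((Iio c) ×ˢ (univ : Set (Fin n → ℝ))) :=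
    measurableSet_Iio.prod MeasurableSet.univ
  have iN : Integrable (fun p : ℝ × (Fin n → ℝ) => (p.1 - c) * f p) :=
    hf.integrable_mul (k := fun p => p.1 - c) (by fun_prop) volume
  have iM : ∀ i, Integrable (fun p : ℝ × (Fin n → ℝ) => p.2 i * f p) := fun i =>
    hf.integrable_mul (k := fun p => p.2 i) (by fun_prop) volume
  have hNpos : 0 < Np := by
    have h1 : 0 ≤ Np := setIntegral_nonneg msI fun p hp =>
      mul_nonneg (sub_nonneg.2 (le_of_lt hp.1)) (hf.nonneg p)
    rcases h1.eq_or_lt with h2 | h2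
    · exfalso
      have h3 := (setIntegral_eq_zero_iff_of_nonneg_ae (μ := volume)
        (s := (Ioi c) ×ˢ (univ : Set (Fin n → ℝ))) (f := fun p => (p.1 - c) * f p)
        (by
          filter_upwards [ae_restrict_mem msI] with p hp
          exact mul_nonneg (sub_nonneg.2 (le_of_lt hp.1)) (hf.nonneg p)) iN.integrableOn).1 h2.symm
      have h4 : ∫ p in (Ioi c) ×ˢ univ, f p = 0 := by
        apply integral_eq_zero_of_ae
        filter_upwards [h3, ae_restrict_mem msI] with p hp hp2
        have : p.1 - c ≠ 0 := sub_ne_zero.2 (ne_of_gt hp2.1)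
        simpa [this] using hp
      rw [hc1] at h4
      exact hmpos.ne' h4
    · exact h2
  have hNneg : Nm ≤ 0 := setIntegral_nonpos msI' fun p hp =>
      mul_nonpos_of_nonpos_of_nonneg (sub_nonpos.2 (le_of_lt hp.1)) (hf.nonneg p)
  have hd : Np - Nm ≠ 0 := by linarith
  let w : Fin n → ℝ := fun i => (Mp i - Mm i) / (Np - Nm)
  let a : Fin n → ℝ := fun i => (Mp i - Np * w i) / m
  have eqp : ∀ i, Mp i - m * a i - Np * w i = 0 := by
    intro i; simp only [a]; field_simp; ring
  have eqm : ∀ i, Mm i - m * a i - Nm * w i = 0 := by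
    intro i
    have h1 : Mp i - Mm i = (Np - Nm) * w i := by simp only [w]; field_simp
    have h2 := eqp i
    linarith
  -- transformed functions
  let f1 : ℝ × (Fin n → ℝ) → ℝ := fun p => f (shearA c a w p)
  let g0 : ℝ × (Fin n → ℝ) → ℝ := fun q => rexp (c * q.1 + dotProduct a q.2) * g q
  let g1 : ℝ × (Fin n → ℝ) → ℝ := fun q => g0 (shearB w q)
  have nf1 : NiceFn f1 := hf.comp_cont (shearA c a w).continuous (shearA c a w).symm.continuous
    (fun x => (shearA c a w).symm_apply_apply x)
  have ng0 : NiceFn g0 := hg.mul_cont (k := fun q => rexp (c * q.1 + dotProduct a q.2))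
    (by unfold dotProduct; fun_prop) (fun x => (Real.exp_pos _).le)
  have ng1 : NiceFn g1 := ng0.comp_cont (shearB w).continuous (shearB w).symm.continuous
    (fun x => (shearB w).symm_apply_apply x)
  have pair : ∀ p q : ℝ × (Fin n → ℝ), f1 p * g1 q ≤ rexp (-(p.1 * q.1 + dotProduct p.2 q.2)) := by
    intro p q
    have h1 := H (shearA c a w p) (shearB w q)
    simp only [f1, g1, g0]
    calc _ = rexp (c * (shearB w q).1 + dotProduct a (shearB w q).2) *
          (f (shearA c a w p) * g (shearB w q)) := by ring
      _ ≤ rexp (c * (shearB w q).1 + dotProduct a (shearB w q).2) *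
          rexp (-((shearA c a w p).1 * (shearB w q).1 +
            dotProduct (shearA c a w p).2 (shearB w q).2)) := by gcongr
      _ = _ := by
        rw [← Real.exp_add]
        congr 1
        simp only [shearA, shearB, Homeomorph.homeomorph_mk_coe, Equiv.coe_fn_mk, add_dotProduct,
          smul_dotProduct, smul_eq_mul]
        ring
  have mom : ∀ (S S' : Set ℝ), (∀ t, t ∈ S ↔ c + t ∈ S') → ∀ i,
      ∫ p in S ×ˢ (univ : Set (Fin n → ℝ)), p.2 i * f1 p =
        (∫ p in S' ×ˢ (univ : Set (Fin n → ℝ)), p.2 i * f p)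
         - (∫ p in S' ×ˢ (univ : Set (Fin n → ℝ)), f p) * a i
         - (∫ p in S' ×ˢ (univ : Set (Fin n → ℝ)), (p.1 - c) * f p) * w i := by
    intro S S' hS i
    have h1 := shearA_setIntegral c a w (fun p => (p.2 i - a i - (p.1 - c) * w i) * f p) S S' hS
    have h2 : ∀ p : ℝ × (Fin n → ℝ), p.2 i * f1 p =
        (fun p => (p.2 i - a i - (p.1 - c) * w i) * f p) (shearA c a w p) := by
      intro p
      simp only [f1]
      congr 1
      simp [shearA]
      ring
    simp only [h2]
    rw [h1]
    have e : ∀ p : ℝ × (Fin n → ℝ), (p.2 i - a i - (p.1 - c) * w i) * f p =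
      p.2 i * f p - f p * a i - (p.1 - c) * f p * w i := by intro p; ring
    simp only [e]
    rw [integral_sub, integral_sub, integral_mul_const, integral_mul_const]
    · exact (iM i).integrableOn
    · exact ((hf.integrable volume).mul_const _).integrableOn
    · exact ((iM i).sub ((hf.integrable volume).mul_const _)).integrableOn
    · exact (iN.mul_const _).integrableOn
  have hI : ∀ t, t ∈ Ioi (0:ℝ) ↔ c + t ∈ Ioi c := fun t => by simp
  have hI' : ∀ t, t ∈ Iio (0:ℝ) ↔ c + t ∈ Iio c := fun t => by simp
  have B := santalo_balanced IH nf1 ng1 pair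
    (fun i => by rw [mom _ _ hI i, hc1]; exact eqp i)
    (fun i => by rw [mom _ _ hI' i, hc2]; exact eqm i)
    (by
      have e1 := shearA_setIntegral c a w f _ _ hI
      have e2 := shearA_setIntegral c a w f _ _ hI'
      simp only [f1]
      rw [e1, e2, hc1, hc2])
  have e1 : ∫ p, f1 p = ∫ p, f p :=
    (shearA_mp c a w).integral_comp (shearA c a w).measurableEmbedding f
  have e2 : ∫ p, g1 p = ∫ p, g0 p :=
    (shearB_mp w).integral_comp (shearB w).measurableEmbedding g0
  have e3 : ∫ p, g p ≤ ∫ p, g0 p := by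
    have i1 : Integrable (fun p : ℝ × (Fin n → ℝ) => p.1 * g p) :=
      hg.integrable_mul (k := fun p => p.1) (by fun_prop) volume
    have i2 : ∀ i, Integrable (fun p : ℝ × (Fin n → ℝ) => p.2 i * g p) := fun i =>
      hg.integrable_mul (k := fun p => p.2 i) (by fun_prop) volume
    have h1 : ∫ p, g p = ∫ p : ℝ × (Fin n → ℝ),
        (g p + c * (p.1 * g p) + ∑ i, a i * (p.2 i * g p)) := by
      rw [integral_add, integral_add, integral_const_mul, hb, integral_finsetSum]
      · simp [integral_const_mul, hb']
      · exact fun i _ => (i2 i).const_mul _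
      · exact hg.integrable volume
      · exact i1.const_mul _
      · exact (hg.integrable volume).add (i1.const_mul _)
      · exact integrable_finsetSum _ fun i _ => (i2 i).const_mul _
    rw [h1]
    apply integral_mono
    · exact ((hg.integrable volume).add (i1.const_mul _)).add
        (integrable_finsetSum _ fun i _ => (i2 i).const_mul _)
    · exact ng0.integrable volume
    · intro p
      simp only [g0]
      have h2 : g p + c * (p.1 * g p) + ∑ i, a i * (p.2 i * g p) =
          (c * p.1 + dotProduct a p.2 + 1) * g p := by
        unfold dotProduct
        rw [add_mul, add_mul, Finset.sum_mul]
        simp only [mul_assoc]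
        ring
      rw [h2]
      exact mul_le_mul_of_nonneg_right (Real.add_one_le_exp _) (hg.nonneg p)
  rw [e1, e2] at B
  exact (mul_le_mul_of_nonneg_left e3 hf0).trans B

theorem santaloFn (n : ℕ) : SantaloFn n := by
  induction n with
  | zero =>
    intro f g hf hg H hb
    have : (volume : Measure (Fin 0 → ℝ)) = Measure.dirac 0 := by
      rw [volume_pi]; exact Measure.pi_of_empty _ _
    simp only [this]
    simp
    simpa using H 0 0
  | succ n IH =>
    intro f g hf hg H hb
    let e := MeasurableEquiv.piFinSuccAbove (fun _ : Fin (n + 1) => ℝ) 0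
    have he : MeasurePreserving e volume volume :=
      volume_preserving_piFinSuccAbove (fun _ : Fin (n + 1) => ℝ) 0
    have hes : ∀ p : ℝ × (Fin n → ℝ), e.symm p = Fin.cons p.1 p.2 := by
      intro p; simp [e, MeasurableEquiv.piFinSuccAbove, Fin.insertNthEquiv]
    have nice : ∀ f : (Fin (n+1) → ℝ) → ℝ, NiceFn f → NiceFn (fun p => f (e.symm p)) := by
      intro f hf
      obtain ⟨C, hC⟩ := hf.bdd
      obtain ⟨R, hR⟩ := hf.supp
      refine ⟨hf.meas.comp e.symm.measurable, fun x => hf.nonneg _, ⟨C, fun x => hC _⟩, ⟨R, ?_⟩⟩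
      intro p hp
      have h1 := hR _ hp
      rw [hes] at h1
      have hR0 := (norm_nonneg _).trans h1
      rw [pi_norm_le_iff_of_nonneg hR0] at h1
      rw [Prod.norm_def]
      refine max_le (by simpa using h1 0) ?_
      rw [pi_norm_le_iff_of_nonneg hR0]
      intro i
      simpa using h1 i.succ
    have tr : ∀ F : (Fin (n+1) → ℝ) → ℝ, ∫ x, F x = ∫ p, F (e.symm p) := fun F =>
      (he.symm.integral_comp e.symm.measurableEmbedding F).symm
    have := santalo_step IH (nice g hg) (nice f hf)
      (fun p q => by
        have := H (e.symm q) (e.symm p)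
        rw [mul_comm]
        refine this.trans (le_of_eq ?_)
        rw [hes, hes]
        congr 2
        simp only [dotProduct, Fin.sum_univ_succ, Fin.cons_zero, Fin.cons_succ]
        simp only [mul_comm])
      (by
        have := hb 0
        rw [tr] at this
        simpa [hes] using this)
      (fun i => by
        have := hb i.succ
        rw [tr] at this
        simpa [hes] using this)
    rw [tr f, tr g, mul_comm]
    exact this

lemma polar_integral {E : Type*} [NormedAddCommGroup E] [NormedSpace ℝ E] [MeasurableSpace E]
    [BorelSpace E] [FiniteDimensional ℝ E] [Nontrivial E] (μ : Measure E) [μ.IsAddHaarMeasure]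
    {F : E → ℝ} (hF : Integrable F μ) :
    ∫ x, F x ∂μ = ∫ u : sphere (0:E) 1, (∫ r in Ioi (0:ℝ),
      r ^ (Module.finrank ℝ E - 1) * F (r • (u : E))) ∂(μ.toSphere) := by
  have mp := μ.measurePreserving_homeomorphUnitSphereProd
  let G : sphere (0:E) 1 × Ioi (0:ℝ) → ℝ := fun p => F ((p.2 : ℝ) • (p.1 : E))
  have hG : ∀ x : ({(0)}ᶜ : Set E), G (homeomorphUnitSphereProd E x) = F x := by
    intro x
    have hx : ‖(x:E)‖ ≠ 0 := norm_ne_zero_iff.2 x.2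
    simp only [G, homeomorphUnitSphereProd_apply_fst_coe, homeomorphUnitSphereProd_apply_snd_coe]
    rw [smul_inv_smul₀ hx]
  have hintA : Integrable G (μ.toSphere.prod (.volumeIoiPow (Module.finrank ℝ E - 1))) := by
    rw [← mp.integrable_comp_emb (Homeomorph.measurableEmbedding _)]
    have : G ∘ (homeomorphUnitSphereProd E) = F ∘ Subtype.val := funext hG
    rw [this, ← integrableOn_iff_comap_subtypeVal (measurableSet_singleton _).compl]
    exact hF.integrableOn
  calc ∫ x, F x ∂μ
    _ = ∫ x : ({(0)}ᶜ : Set E), F x.1 ∂(μ.comap (↑)) := by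
      rw [integral_subtype_comap (measurableSet_singleton _).compl (fun x ↦ F x),
        restrict_compl_singleton]
    _ = ∫ p, G p ∂μ.toSphere.prod (.volumeIoiPow (Module.finrank ℝ E - 1)) := by
      rw [← mp.integral_comp (Homeomorph.measurableEmbedding _)]
      exact integral_congr_ae (ae_of_all _ fun x => (hG x).symm)
    _ = ∫ u, (∫ r, G (u, r) ∂(.volumeIoiPow (Module.finrank ℝ E - 1))) ∂μ.toSphere :=
      integral_prod _ hintA
    _ = _ := by
      congr 1
      ext u
      simp only [Measure.volumeIoiPow, ENNReal.ofReal, G]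
      rw [integral_withDensity_eq_integral_smul,
        integral_subtype_comap measurableSet_Ioi fun a ↦
          Real.toNNReal (a ^ (Module.finrank ℝ E - 1)) • F (a • (u : E)),
        setIntegral_congr_fun measurableSet_Ioi fun x hx ↦ ?_]
      · rw [NNReal.smul_def, Real.coe_toNNReal _ (pow_nonneg hx.out.le _), smul_eq_mul]
      · exact (measurable_subtype_coe.pow_const _).real_toNNReal

lemma polar_hom {E : Type*} [NormedAddCommGroup E] [NormedSpace ℝ E] [MeasurableSpace E]
    [BorelSpace E] [FiniteDimensional ℝ E] [Nontrivial E] (μ : Measure E) [μ.IsAddHaarMeasure]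
    {n : ℕ} (hn : Module.finrank ℝ E = n) (d : ℕ) {k h : E → ℝ} {F : ℝ → ℝ}
    (hintA : Integrable (fun x => k x * F (h x)) μ)
    (hk : ∀ r : ℝ, 0 < r → ∀ u ∈ sphere (0:E) 1, k (r • u) = r ^ d * k u)
    (hh : ∀ r : ℝ, 0 < r → ∀ u ∈ sphere (0:E) 1, h (r • u) = r * h u)
    (hpos : ∀ u ∈ sphere (0:E) 1, 0 < h u) :
    ∫ x, k x * F (h x) ∂μ = (∫ s in Ioi (0:ℝ), s ^ (n - 1 + d) * F s) *
      ∫ u : sphere (0:E) 1, k u * ((h u) ^ (n + d))⁻¹ ∂(μ.toSphere) := by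
  rw [polar_integral μ hintA, hn, ← integral_const_mul]
  have hn1 : 1 ≤ n := hn ▸ Module.finrank_pos
  congr 1
  ext u
  have hu := hpos u u.2
  have e1 : ∫ r in Ioi (0:ℝ), r ^ (n - 1) * (k (r • (u:E)) * F (h (r • (u:E)))) =
      ∫ r in Ioi (0:ℝ), (k u * ((h u) ^ (n - 1 + d))⁻¹) *
        ((fun s => s ^ (n - 1 + d) * F s) (h u * r)) := by
    apply setIntegral_congr_fun measurableSet_Ioi
    intro r hr
    simp only
    rw [hk r hr u u.2, hh r hr u u.2, mul_comm (h u) r, mul_pow, pow_add r]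
    field_simp
  rw [e1, integral_const_mul, integral_comp_mul_left_Ioi (fun s => s ^ (n - 1 + d) * F s) 0 hu, mul_zero, smul_eq_mul]
  have : n + d = n - 1 + d + 1 := by omega
  rw [this, pow_succ (h ↑u), mul_inv]
  ring

section suppfacts
variable {n : ℕ} {K : Set (EuclideanSpace ℝ (Fin n))}

lemma supp_bdd (hK : IsCompact K) (u : EuclideanSpace ℝ (Fin n)) :
    BddAbove ((fun x => ⟪x, u⟫) '' K) :=
  (hK.image (by fun_prop)).bddAbove

lemma le_supp (hK : IsCompact K) (u : EuclideanSpace ℝ (Fin n)) {y : EuclideanSpace ℝ (Fin n)}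
    (hy : y ∈ K) : ⟪y, u⟫ ≤ supp K u :=
  le_csSup (supp_bdd hK u) ⟨y, hy, rfl⟩

lemma exists_supp (hK : IsCompact K) (hne : K.Nonempty) (u : EuclideanSpace ℝ (Fin n)) :
    ∃ y ∈ K, supp K u = ⟪y, u⟫ := by
  obtain ⟨y, hy, h⟩ := (hK.image (f := fun x => ⟪x, u⟫) (by fun_prop)).sSup_mem (hne.image _)
  exact ⟨y, hy, h.symm⟩

lemma supp_smul (hK : IsCompact K) (hne : K.Nonempty) {r : ℝ} (hr : 0 < r)
    (u : EuclideanSpace ℝ (Fin n)) : supp K (r • u) = r * supp K u := by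
  apply le_antisymm
  · obtain ⟨y, hy, h⟩ := exists_supp hK hne (r • u)
    rw [h, inner_smul_right]
    exact mul_le_mul_of_nonneg_left (le_supp hK u hy) hr.le
  · obtain ⟨y, hy, h⟩ := exists_supp hK hne u
    rw [h, ← inner_smul_right]
    exact le_supp hK _ hy

lemma supp_continuous (hK : IsCompact K) (hne : K.Nonempty) : Continuous (supp K) := by
  obtain ⟨C, hC⟩ := hK.isBounded.exists_norm_le
  have hC0 : 0 ≤ C := by
    obtain ⟨y, hy⟩ := hne
    exact (norm_nonneg _).trans (hC y hy)
  refine (LipschitzWith.of_le_add_mul (⟨C, hC0⟩ : NNReal) ?_).continuous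
  intro u v
  obtain ⟨y, hy, h⟩ := exists_supp hK hne u
  have h1 := le_supp hK v hy
  have h2 : ⟪y, u⟫ = ⟪y, v⟫ + ⟪y, u - v⟫ := by rw [inner_sub_right]; ring
  have h3 : ⟪y, u - v⟫ ≤ C * ‖u - v‖ :=
    (real_inner_le_norm _ _).trans (mul_le_mul_of_nonneg_right (hC y hy) (norm_nonneg _))
  rw [h, h2, dist_eq_norm]
  change _ ≤ supp K v + C * ‖u - v‖
  linarith

lemma supp_lower (hK : IsCompact K) {x : EuclideanSpace ℝ (Fin n)} (hx : x ∈ interior K) :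
    ∃ ρ : ℝ, 0 < ρ ∧ ∀ u : EuclideanSpace ℝ (Fin n), ρ * ‖u‖ ≤ supp K u - ⟪x, u⟫ := by
  obtain ⟨ρ, hρ, hb⟩ := Metric.nhds_basis_closedBall.mem_iff.1 (mem_interior_iff_mem_nhds.1 hx)
  refine ⟨ρ, hρ, fun u => ?_⟩
  by_cases hu : u = 0
  · subst hu
    have := le_supp hK 0 (interior_subset hx)
    simp at this ⊢
    exact this
  have hu' : ‖u‖ ≠ 0 := norm_ne_zero_iff.2 hu
  have hm : x + (ρ * ‖u‖⁻¹) • u ∈ K := by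
    apply hb
    rw [mem_closedBall, dist_eq_norm]
    simp only [add_sub_cancel_left, norm_smul, norm_mul, norm_inv, norm_norm]
    rw [mul_assoc, inv_mul_cancel₀ hu', mul_one, Real.norm_of_nonneg hρ.le]
  have := le_supp hK u hm
  rw [inner_add_left, inner_smul_left, real_inner_self_eq_norm_sq] at this
  simp only [conj_trivial] at this
  have e : ρ * ‖u‖⁻¹ * ‖u‖ ^ 2 = ρ * ‖u‖ := by field_simp
  linarith

lemma supp_upper (hK : IsCompact K) {x : EuclideanSpace ℝ (Fin n)} (hx : x ∈ K)
    (u : EuclideanSpace ℝ (Fin n)) : supp K u - ⟪x, u⟫ ≤ Metric.diam K * ‖u‖ := by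
  obtain ⟨y, hy, h⟩ := exists_supp hK ⟨x, hx⟩ u
  rw [h, ← inner_sub_left]
  refine (real_inner_le_norm _ _).trans (mul_le_mul_of_nonneg_right ?_ (norm_nonneg _))
  rw [← dist_eq_norm]
  exact Metric.dist_le_diam_of_mem hK.isBounded hy hx

end suppfacts

lemma santaloE {n : ℕ} {f g : EuclideanSpace ℝ (Fin n) → ℝ} (hf : NiceFn f) (hg : NiceFn g)
    (hfg : ∀ x y, f x * g y ≤ rexp (-⟪x, y⟫)) (hb : ∀ i, ∫ x, x i * f x = 0) :
    (∫ x, f x) * (∫ x, g x) ≤ (2 * π) ^ n := by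
  have mp := PiLp.volume_preserving_toLp (Fin n)
  have me : MeasurableEmbedding (@WithLp.toLp 2 (Fin n → ℝ)) :=
    (MeasurableEquiv.toLp 2 (Fin n → ℝ)).measurableEmbedding
  have tr : ∀ F : EuclideanSpace ℝ (Fin n) → ℝ, ∫ x, F x = ∫ x : Fin n → ℝ, F (WithLp.toLp 2 x) :=
    fun F => (mp.integral_comp me F).symm
  have nice : ∀ F : EuclideanSpace ℝ (Fin n) → ℝ, NiceFn F →
      NiceFn (fun x : Fin n → ℝ => F (WithLp.toLp 2 x)) := by
    intro F hF
    refine ⟨hF.meas.comp me.measurable, fun x => hF.nonneg _, ?_, ?_⟩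
    · obtain ⟨C, hC⟩ := hF.bdd
      exact ⟨C, fun x => hC _⟩
    · obtain ⟨R, hR⟩ := hF.supp
      refine ⟨R, fun x hx => ?_⟩
      refine le_trans ?_ (hR _ hx)
      refine (pi_norm_le_iff_of_nonneg (norm_nonneg _)).2 fun i => ?_
      exact PiLp.norm_apply_le (WithLp.toLp 2 x) i
  rw [tr f, tr g]
  refine santaloFn n _ _ (nice f hf) (nice g hg) ?_ ?_
  · intro x y
    refine (hfg _ _).trans (le_of_eq ?_)
    congr 2
    rw [EuclideanSpace.inner_eq_star_dotProduct]
    simp [dotProduct_comm]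
  · intro i
    have := hb i
    rw [tr] at this
    exact this

/-- truncation -/
noncomputable def cutF (φ : ℝ → ℝ) (R s : ℝ) : ℝ := if s ≤ R then φ s else 0

lemma nice_cut {n : ℕ} {h : EuclideanSpace ℝ (Fin n) → ℝ} (hc : Continuous h) {c : ℝ} (hc0 : 0 < c)
    (hlow : ∀ x, c * ‖x‖ ≤ h x) {φ : ℝ → ℝ} (hφ : Continuous φ) (h0 : ∀ s, 0 ≤ φ s)
    (h1 : ∀ s, φ s ≤ 1) (R : ℝ) : NiceFn (fun x => cutF φ R (h x)) := by
  refine ⟨?_, ?_, ⟨1, ?_⟩, ⟨R / c, ?_⟩⟩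
  · unfold cutF
    exact Measurable.ite (measurableSet_le hc.measurable measurable_const)
      (hφ.comp hc).measurable measurable_const
  · intro x
    unfold cutF
    split_ifs
    · exact h0 _
    · exact le_rfl
  · intro x
    unfold cutF
    split_ifs
    · exact h1 _
    · exact zero_le_one
  · intro x hx
    have : h x ≤ R := by
      by_contra hcon
      exact hx (by simp [cutF, hcon])
    rw [le_div_iff₀ hc0, mul_comm]
    exact (hlow x).trans this

lemma cut_one_integral (m : ℕ) : ∫ s in Ioi (0:ℝ), s ^ m * cutF (fun _ => 1) 1 s = 1 / (m + 1) := by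
  have : ∀ s : ℝ, s ^ m * cutF (fun _ => 1) 1 s = (Iic (1:ℝ)).indicator (fun s => s ^ m) s := by
    intro s
    by_cases hs : s ≤ 1
    · simp [cutF, hs]
    · simp [cutF, hs]
  simp_rw [this]
  rw [setIntegral_indicator measurableSet_Iic, Ioi_inter_Iic,
    ← intervalIntegral.integral_of_le zero_le_one, integral_pow]
  simp

lemma gauss_radial_integrable (n : ℕ) :
    IntegrableOn (fun s : ℝ => s ^ n * rexp (-s ^ 2 / 2)) (Ioi 0) := by
  have := integrableOn_rpow_mul_exp_neg_mul_sq (b := 1/2) (by norm_num) (s := n)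
    (by have : (0:ℝ) ≤ n := Nat.cast_nonneg n
        linarith)
  refine this.congr_fun ?_ measurableSet_Ioi
  intro s _
  simp only [rpow_natCast]
  congr 2
  ring

lemma cut_tendsto (n : ℕ) : Filter.Tendsto
    (fun N : ℕ => ∫ s in Ioi (0:ℝ), s ^ n * cutF (fun s => rexp (-s ^ 2 / 2)) N s) Filter.atTop
    (nhds (∫ s in Ioi (0:ℝ), s ^ n * rexp (-s ^ 2 / 2))) := by
  refine tendsto_integral_of_dominated_convergence (fun s => s ^ n * rexp (-s ^ 2 / 2)) ?_
    (gauss_radial_integrable n) ?_ ?_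
  · intro N
    apply Measurable.aestronglyMeasurable
    apply Measurable.mul (by fun_prop)
    unfold cutF
    exact Measurable.ite (measurableSet_le measurable_id measurable_const)
      (by fun_prop) measurable_const
  · intro N
    refine (ae_restrict_iff' measurableSet_Ioi).2 (ae_of_all _ fun s hs => ?_)
    have hs' : (0:ℝ) < s := hs
    unfold cutF
    split_ifs
    · rw [Real.norm_of_nonneg (by positivity)]
    · simp only [mul_zero, norm_zero]
      positivity
  · refine ae_of_all _ fun s => ?_
    apply tendsto_const_nhds.congr'
    obtain ⟨N, hN⟩ := exists_nat_ge s
    filter_upwards [Filter.eventually_ge_atTop N] with M hM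
    have : s ≤ M := hN.trans (by exact_mod_cast hM)
    simp [cutF, this]

lemma sph_total (n : ℕ) : ((sphMeasure n) Set.univ).toReal = n * vol (unitBall n) := by
  unfold sphMeasure
  rw [Measure.toSphere_apply_univ]
  rcases Nat.eq_zero_or_pos n with h | h
  · subst h; simp
  have : Nonempty (Fin n) := ⟨⟨0, h⟩⟩
  rw [vol, unitBall, Measure.addHaar_closedBall_eq_addHaar_ball]
  simp

lemma gauss_const {n : ℕ} (hn : 1 ≤ n) :
    (∫ s in Ioi (0:ℝ), s ^ (n - 1) * rexp (-s ^ 2 / 2)) * ((sphMeasure n) Set.univ).toReal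
      = (2 * π) ^ ((n : ℝ) / 2) := by
  have : Nonempty (Fin n) := ⟨⟨0, hn⟩⟩
  have hg := GaussianFourier.integral_rexp_neg_mul_sq_norm (V := EuclideanSpace ℝ (Fin n))
    (b := 1/2) (by norm_num)
  have hintA : Integrable (fun x : EuclideanSpace ℝ (Fin n) => (1:ℝ) * rexp (-‖x‖ ^ 2 / 2)) := by
    by_contra hcon
    have e : (fun x : EuclideanSpace ℝ (Fin n) => (1:ℝ) * rexp (-‖x‖ ^ 2 / 2)) =
      fun x => rexp (-(1/2) * ‖x‖ ^ 2) := by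
      ext x
      rw [one_mul]
      congr 1
      ring
    rw [e] at hcon
    rw [integral_undef hcon] at hg
    have : 0 < (π / (1/2)) ^ ((Module.finrank ℝ (EuclideanSpace ℝ (Fin n)) : ℝ) / 2) := by
      positivity
    exact this.ne hg
  have := polar_hom (volume : Measure (EuclideanSpace ℝ (Fin n))) (n := n) (by simp) 0
    (k := fun _ => 1) (h := fun x => ‖x‖) (F := fun s => rexp (-s ^ 2 / 2)) hintA (by simp)
    (by intro r hr u hu; rw [norm_smul, Real.norm_of_nonneg hr.le])
    (by intro u hu; rw [mem_sphere_zero_iff_norm.1 hu]; norm_num)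
  have e2 : ∫ u : sphere (0:EuclideanSpace ℝ (Fin n)) 1, (1:ℝ) * (‖(u:EuclideanSpace ℝ (Fin n))‖ ^ (n + 0))⁻¹
      ∂((volume : Measure (EuclideanSpace ℝ (Fin n))).toSphere) = ((sphMeasure n) Set.univ).toReal := by
    simp [sphMeasure, Measure.real]
  rw [e2] at this
  rw [add_zero] at this
  rw [← this]
  simp only [finrank_euclideanSpace, Fintype.card_fin] at hg
  have e3 : π / (1/2) = 2 * π := by ring
  rw [e3] at hg
  rw [← hg]
  congr 1
  ext x
  rw [one_mul]
  congr 1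
  ring

lemma santalo_centered {n : ℕ} (hn : 1 ≤ n) {L : Set (EuclideanSpace ℝ (Fin n))} (hL : IsCompact L)
    (hLc : Convex ℝ L) (h0 : (0 : EuclideanSpace ℝ (Fin n)) ∈ interior L)
    (hbar : ∀ i, ∫ x in L, x i = 0) :
    (n * vol L) * ∫ u : sphere (0 : EuclideanSpace ℝ (Fin n)) 1, ((supp L u) ^ n)⁻¹ ∂(sphMeasure n)
      ≤ ((sphMeasure n) Set.univ).toReal ^ 2 := by
  have : Nonempty (Fin n) := ⟨⟨0, hn⟩⟩
  have hne : L.Nonempty := ⟨0, interior_subset h0⟩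
  have hnh : L ∈ nhds 0 := mem_interior_iff_mem_nhds.1 h0
  have habs := absorbent_nhds_zero (𝕜 := ℝ) hnh
  obtain ⟨C, hC0, hC⟩ := hL.isBounded.exists_pos_norm_le
  set p := gauge L with hp
  have pc : Continuous p := continuous_gauge hLc hnh
  have plow : ∀ x, C⁻¹ * ‖x‖ ≤ p x := by
    intro x
    have := le_gauge_of_subset_closedBall (x := x) habs hC0.le
      (fun y hy => by simpa using hC y hy)
    rw [div_eq_inv_mul] at this
    exact this
  have ppos : ∀ u ∈ sphere (0 : EuclideanSpace ℝ (Fin n)) 1, 0 < p u := by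
    intro u hu
    refine lt_of_lt_of_le ?_ (plow u)
    rw [mem_sphere_zero_iff_norm.1 hu]
    positivity
  have phom : ∀ r : ℝ, 0 < r → ∀ u ∈ sphere (0 : EuclideanSpace ℝ (Fin n)) 1,
      p (r • u) = r * p u := fun r hr u _ => gauge_smul_of_nonneg hr.le u
  obtain ⟨ρ, hρ, slow⟩ := supp_lower hL h0
  simp only [inner_zero_left, sub_zero] at slow
  have spos : ∀ u ∈ sphere (0 : EuclideanSpace ℝ (Fin n)) 1, 0 < supp L u := by
    intro u hu
    refine lt_of_lt_of_le ?_ (slow u)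
    rw [mem_sphere_zero_iff_norm.1 hu]
    positivity
  have shom : ∀ r : ℝ, 0 < r → ∀ u ∈ sphere (0 : EuclideanSpace ℝ (Fin n)) 1,
      supp L (r • u) = r * supp L u := fun r hr u _ => supp_smul hL hne hr u
  have sc := supp_continuous hL hne
  set γ : ℝ → ℝ := fun s => rexp (-s ^ 2 / 2) with hγ
  have γc : Continuous γ := by fun_prop
  have γ0 : ∀ s, 0 ≤ γ s := fun s => (exp_pos _).le
  have γ1 : ∀ s, γ s ≤ 1 := fun s => by
    rw [hγ]
    simp only [exp_le_one_iff]
    nlinarith [sq_nonneg s]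
  have hpair : ∀ x y : EuclideanSpace ℝ (Fin n), ⟪x, y⟫ ≤ p x * supp L y := by
    intro x y
    by_cases hx : x = 0
    · subst hx
      rw [hp]
      simp
    have hpx : 0 < p x := lt_of_lt_of_le (by have := norm_pos_iff.2 hx; positivity) (plow x)
    have hm : (p x)⁻¹ • x ∈ L := by
      rw [← hL.isClosed.closure_eq, ← gauge_le_one_iff_mem_closure hLc hnh,
        gauge_smul_of_nonneg (inv_nonneg.2 hpx.le), smul_eq_mul]
      exact (inv_mul_cancel₀ hpx.ne').le
    have := le_supp hL y hm
    rw [inner_smul_left] at this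
    simp only [conj_trivial] at this
    rwa [inv_mul_le_iff₀ hpx] at this
  set A := ∫ u : sphere (0 : EuclideanSpace ℝ (Fin n)) 1, ((p u) ^ n)⁻¹ ∂(sphMeasure n) with hA
  set Bb := ∫ u : sphere (0 : EuclideanSpace ℝ (Fin n)) 1, ((supp L u) ^ n)⁻¹ ∂(sphMeasure n) with hB
  have hind : ∀ x, cutF (fun _ => 1) 1 (p x) = L.indicator (fun _ => (1:ℝ)) x := by
    intro x
    have : p x ≤ 1 ↔ x ∈ L := by
      rw [hp, gauge_le_one_iff_mem_closure hLc hnh, hL.isClosed.closure_eq]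
    by_cases hx : x ∈ L
    · simp [cutF, this.2 hx, hx]
    · simp [cutF, mt this.1 hx, hx]
  have nice1 := nice_cut pc (inv_pos.2 hC0) plow (φ := fun _ => (1:ℝ)) continuous_const
    (fun _ => zero_le_one) (fun _ => le_rfl) 1
  have hvolA : (n : ℝ) * vol L = A := by
    have := polar_hom (volume : Measure (EuclideanSpace ℝ (Fin n))) (n := n) (by simp) 0
      (k := fun _ => 1) (h := p) (F := cutF (fun _ => 1) 1) (nice1.integrable_mul continuous_const _)
      (by simp) phom ppos
    rw [add_zero, cut_one_integral] at this
    simp_rw [hind, one_mul, add_zero] at this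
    rw [integral_indicator hL.measurableSet] at this
    have e1 : ∫ x in L, (1:ℝ) = vol L := by simp [vol, Measure.real]
    rw [e1] at this
    have hn' : ((n - 1 : ℕ) : ℝ) + 1 = n := by
      rw [Nat.cast_sub hn]; simp
    rw [hn'] at this
    rw [this, hA]
    have : (n:ℝ) ≠ 0 := by positivity
    unfold sphMeasure
    field_simp
  have hQ : ∀ i, ∫ u : sphere (0 : EuclideanSpace ℝ (Fin n)) 1, (u : EuclideanSpace ℝ (Fin n)) i *
      ((p u) ^ (n + 1))⁻¹ ∂((volume : Measure (EuclideanSpace ℝ (Fin n))).toSphere) = 0 := by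
    intro i
    have := polar_hom (volume : Measure (EuclideanSpace ℝ (Fin n))) (n := n) (by simp) 1
      (k := fun x => x i) (h := p) (F := cutF (fun _ => 1) 1)
      (nice1.integrable_mul (by fun_prop) _)
      (by intro r hr u hu; simp) phom ppos
    rw [cut_one_integral] at this
    simp_rw [hind] at this
    have e1 : ∫ x : EuclideanSpace ℝ (Fin n), x i * L.indicator (fun _ => (1:ℝ)) x = 0 := by
      rw [← hbar i, ← integral_indicator hL.measurableSet]
      congr 1
      ext x
      by_cases hx : x ∈ L <;> simp [hx]
    rw [e1] at this
    rcases mul_eq_zero.1 this.symm with h | h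
    · exfalso
      have : (0:ℝ) < 1 / (((n - 1 + 1 : ℕ) : ℝ) + 1) := by positivity
      exact this.ne' h
    · exact h
  have key : ∀ N : ℕ, (∫ s in Ioi (0:ℝ), s ^ (n - 1) * cutF γ N s) * A *
      ((∫ s in Ioi (0:ℝ), s ^ (n - 1) * cutF γ N s) * Bb) ≤ (2 * π) ^ n := by
    intro N
    have nf := nice_cut pc (inv_pos.2 hC0) plow γc γ0 γ1 N
    have ng := nice_cut sc hρ slow γc γ0 γ1 N
    have ef := polar_hom (volume : Measure (EuclideanSpace ℝ (Fin n))) (n := n) (by simp) 0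
      (k := fun _ => 1) (h := p) (F := cutF γ N) (nf.integrable_mul continuous_const _)
      (by simp) phom ppos
    have eg := polar_hom (volume : Measure (EuclideanSpace ℝ (Fin n))) (n := n) (by simp) 0
      (k := fun _ => 1) (h := supp L) (F := cutF γ N) (ng.integrable_mul continuous_const _)
      (by simp) shom spos
    simp only [one_mul, add_zero] at ef eg
    have := santaloE nf ng ?_ ?_
    · rw [ef, eg] at this
      exact this
    · intro x y
      have hxy := hpair x y
      have h1 : cutF γ N (p x) ≤ γ (p x) := by
        unfold cutF; split_ifs
        · exact le_rfl
        · exact γ0 _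
      have h2 : cutF γ N (supp L y) ≤ γ (supp L y) := by
        unfold cutF; split_ifs
        · exact le_rfl
        · exact γ0 _
      refine (mul_le_mul h1 h2 (ng.nonneg y) (γ0 _)).trans ?_
      rw [hγ]
      simp only
      rw [← exp_add]
      apply exp_le_exp.2
      nlinarith [sq_nonneg (p x - supp L y)]
    · intro i
      have := polar_hom (volume : Measure (EuclideanSpace ℝ (Fin n))) (n := n) (by simp) 1
        (k := fun x => x i) (h := p) (F := cutF γ N) (nf.integrable_mul (by fun_prop) _)
        (by intro r hr u hu; simp) phom ppos
      rw [hQ i, mul_zero] at this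
      exact this
  have ht := cut_tendsto (n - 1)
  have hlim := le_of_tendsto' ((ht.mul_const A).mul (ht.mul_const Bb)) key
  have hc := gauss_const hn
  set c := ∫ s in Ioi (0:ℝ), s ^ (n - 1) * rexp (-s ^ 2 / 2)
  set ω := ((sphMeasure n) Set.univ).toReal
  have h2 : (c * ω) ^ 2 = (2 * π) ^ n := by
    rw [hc, ← rpow_natCast, ← rpow_mul (by positivity), ← rpow_natCast (2 * π) n]
    congr 1
    push_cast
    ring
  have hc0 : 0 < c ^ 2 := by
    have : (0:ℝ) < (2 * π) ^ n := by positivity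
    have hcne : c ≠ 0 := by
      intro h
      rw [h] at h2
      simp at h2
      linarith
    positivity
  rw [hvolA]
  rw [← h2] at hlim
  have : c ^ 2 * (A * Bb) ≤ c ^ 2 * ω ^ 2 := by nlinarith
  exact le_of_mul_le_mul_left this hc0

lemma supp_translate {n : ℕ} {K : Set (EuclideanSpace ℝ (Fin n))} (hK : IsCompact K)
    (hne : K.Nonempty) (e u : EuclideanSpace ℝ (Fin n)) :
    supp ((fun x => x - e) '' K) u = supp K u - ⟪e, u⟫ := by
  have hc : IsCompact ((fun x => x - e) '' K) := hK.image (by fun_prop)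
  apply le_antisymm
  · obtain ⟨y, ⟨z, hz, rfl⟩, h⟩ := exists_supp hc (hne.image _) u
    rw [h, inner_sub_left]
    linarith [le_supp hK u hz]
  · obtain ⟨y, hy, h⟩ := exists_supp hK hne u
    rw [h, ← inner_sub_left]
    exact le_supp hc u ⟨y, hy, rfl⟩

lemma supp_ball {n : ℕ} {r : ℝ} (hr : 0 ≤ r) {u : EuclideanSpace ℝ (Fin n)} (hu : ‖u‖ = 1) :
    supp (closedBall 0 r) u = r := by
  have hc := isCompact_closedBall (0 : EuclideanSpace ℝ (Fin n)) r
  apply le_antisymm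
  · obtain ⟨y, hy, h⟩ := exists_supp hc ⟨0, by simpa using hr⟩ u
    rw [h]
    refine (real_inner_le_norm _ _).trans ?_
    rw [hu, mul_one]
    simpa using hy
  · have := le_supp hc u (y := r • u) (by simp [norm_smul, hu, abs_of_nonneg hr])
    rw [inner_smul_left, real_inner_self_eq_norm_sq, hu] at this
    simpa using this

lemma santalo_body {n : ℕ} (hn : 1 ≤ n) {K : Set (EuclideanSpace ℝ (Fin n))} (hK : IsConvexBody K)
    (hvol : vol K = vol (unitBall n)) :
    ∃ x₀ ∈ interior K, ∫ u : sphere (0 : EuclideanSpace ℝ (Fin n)) 1,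
      ((supp K u - ⟪x₀, (u : EuclideanSpace ℝ (Fin n))⟫) ^ n)⁻¹ ∂(sphMeasure n)
        ≤ ((sphMeasure n) Set.univ).toReal := by
  have : Nonempty (Fin n) := ⟨⟨0, hn⟩⟩
  obtain ⟨hKc, hKx, a, ha⟩ := hK
  have hne : K.Nonempty := ⟨a, interior_subset ha⟩
  obtain ⟨ρ, hρ, hb⟩ := Metric.nhds_basis_closedBall.mem_iff.1 (isOpen_interior.mem_nhds ha)
  have hfin : volume K ≠ ⊤ := hKc.measure_lt_top.ne
  have hbpos : 0 < volume (closedBall a ρ) := measure_closedBall_pos _ _ hρ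
  have hKpos : 0 < volume K := hbpos.trans_le (measure_mono (hb.trans interior_subset))
  have hintA : IntegrableOn (fun x : EuclideanSpace ℝ (Fin n) => x) K :=
    continuousOn_id.integrableOn_compact hKc
  have : IsFiniteMeasure (volume.restrict K) := ⟨by simpa using hKc.measure_lt_top⟩
  set x₀ := ⨍ x in K, x with hx₀
  have hmem : x₀ ∈ interior K := by
    refine hKx.average_mem_interior_of_set (t := closedBall a ρ) ?_ ?_ hintA ?_
    · rw [Measure.restrict_apply measurableSet_closedBall,
        inter_eq_left.2 (hb.trans interior_subset)]
      exact hbpos.ne'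
    · exact ae_restrict_mem hKc.measurableSet
    · apply hb
      rw [Measure.restrict_restrict measurableSet_closedBall,
        inter_eq_left.2 (hb.trans interior_subset)]
      refine (convex_closedBall a ρ).set_average_mem isClosed_closedBall hbpos.ne'
        (isCompact_closedBall a ρ).measure_lt_top.ne ?_ ?_
      · exact ae_restrict_mem measurableSet_closedBall
      · exact hintA.mono_set (hb.trans interior_subset)
  refine ⟨x₀, hmem, ?_⟩
  set L := (fun x => x - x₀) '' K with hL
  have hLpre : L = (fun x => x + x₀) ⁻¹' K := by
    ext x
    constructor
    · rintro ⟨y, hy, rfl⟩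
      simpa using hy
    · intro hx
      exact ⟨x + x₀, hx, by simp⟩
  have hvolL : vol L = vol K := by
    unfold vol
    rw [hLpre, measure_preimage_add_right]
  have hLc : IsCompact L := hKc.image (by fun_prop)
  have hLx : Convex ℝ L := by
    rw [hLpre]
    exact hKx.translate_preimage_left x₀
  have h0 : (0 : EuclideanSpace ℝ (Fin n)) ∈ interior L := by
    rw [hLpre, mem_interior_iff_mem_nhds]
    apply (continuous_id.add continuous_const).continuousAt.preimage_mem_nhds
    simpa using mem_interior_iff_mem_nhds.1 hmem
  have hbar : ∀ i, ∫ x in L, x i = 0 := by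
    intro i
    have mp := measurePreserving_sub_right (volume : Measure (EuclideanSpace ℝ (Fin n))) x₀
    have e1 := mp.setIntegral_image_emb (MeasurableEquiv.subRight x₀).measurableEmbedding
      (fun x => x i) K
    rw [hL, e1]
    have hi : IntegrableOn (fun x : EuclideanSpace ℝ (Fin n) => x i) K :=
      ContinuousOn.integrableOn_compact hKc (by fun_prop)
    have e2 : (∫ x in K, x) i = ∫ x in K, x i := by
      exact ((EuclideanSpace.proj i : EuclideanSpace ℝ (Fin n) →L[ℝ] ℝ).integral_comp_comm hintA).symm
    have e3 : x₀ i = (volume.real K)⁻¹ * ∫ x in K, x i := by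
      rw [hx₀, setAverage_eq, PiLp.smul_apply, e2, smul_eq_mul]
    simp only [PiLp.sub_apply]
    rw [integral_sub hi (integrable_const _), integral_const, e3]
    have : volume.real K ≠ 0 := (ENNReal.toReal_pos hKpos.ne' hfin).ne'
    simp only [measureReal_restrict_apply_univ, smul_eq_mul]
    field_simp
    ring
  have key := santalo_centered hn hLc hLx h0 hbar
  rw [hvolL, hvol, ← sph_total] at key
  have hω : 0 < ((sphMeasure n) Set.univ).toReal := by
    rw [sph_total, ← hvol]
    have : 0 < vol K := ENNReal.toReal_pos hKpos.ne' hfin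
    positivity
  rw [sq] at key
  have := le_of_mul_le_mul_left key hω
  simp_rw [hL, supp_translate hKc hne] at this
  exact this

lemma sph_pos {n : ℕ} (hn : 1 ≤ n) : 0 < ((sphMeasure n) Set.univ).toReal := by
  have : Nonempty (Fin n) := ⟨⟨0, hn⟩⟩
  rw [sph_total]
  have : 0 < vol (unitBall n) :=
    ENNReal.toReal_pos (measure_closedBall_pos _ _ one_pos).ne'
      (isCompact_closedBall _ _).measure_lt_top.ne
  positivity

instance sphMeasure_finite (n : ℕ) : IsFiniteMeasure (sphMeasure n) := by
  unfold sphMeasure; infer_instance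

lemma cont_int {n : ℕ} {f : sphere (0 : EuclideanSpace ℝ (Fin n)) 1 → ℝ} (hf : Continuous f) :
    Integrable f (sphMeasure n) :=
  hf.integrable_of_hasCompactSupport (HasCompactSupport.of_compactSpace f)

/-- pointwise Bernoulli-type inequality -/
lemma bern {n : ℕ} (hn : 2 ≤ n) {h : ℝ} (hh : 0 < h) :
    h ^ (-2 : ℝ) ≤ 1 + (2 / n) * ((h ^ n)⁻¹ - 1) := by
  have hn' : (2:ℝ) ≤ n := by exact_mod_cast hn
  have hx : 0 ≤ h ^ (-2:ℝ) := rpow_nonneg hh.le _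
  have b := one_add_mul_self_le_rpow_one_add (s := h ^ (-2:ℝ) - 1) (by linarith) (p := (n:ℝ)/2)
    (by linarith)
  rw [add_sub_cancel, ← rpow_mul hh.le] at b
  have e : h ^ ((-2:ℝ) * (n/2)) = (h ^ n)⁻¹ := by
    rw [show (-2:ℝ) * (n/2) = -n by ring, rpow_neg hh.le, rpow_natCast]
  rw [e] at b
  have : (2 / n) * ((n:ℝ)/2 * (h ^ (-2:ℝ) - 1)) = h ^ (-2:ℝ) - 1 := by
    field_simp
  have h3 : (2 / n) * ((n:ℝ)/2 * (h ^ (-2:ℝ) - 1)) ≤ (2/n) * ((h ^ n)⁻¹ - 1) := by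
    apply mul_le_mul_of_nonneg_left _ (by positivity)
    linarith
  linarith

lemma hfun_cont {n : ℕ} {K : Set (EuclideanSpace ℝ (Fin n))} (hK : IsCompact K)
    (hne : K.Nonempty) (x : EuclideanSpace ℝ (Fin n)) :
    Continuous (fun u : sphere (0 : EuclideanSpace ℝ (Fin n)) 1 =>
      supp K u - ⟪x, (u : EuclideanSpace ℝ (Fin n))⟫) := by
  have := supp_continuous hK hne
  fun_prop

lemma hfun_pos {n : ℕ} {K : Set (EuclideanSpace ℝ (Fin n))} (hK : IsCompact K)
    {x : EuclideanSpace ℝ (Fin n)} (hx : x ∈ interior K)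
    (u : sphere (0 : EuclideanSpace ℝ (Fin n)) 1) :
      0 < supp K u - ⟪x, (u : EuclideanSpace ℝ (Fin n))⟫ := by
  obtain ⟨ρ, hρ, h⟩ := supp_lower hK hx
  have := h u
  rw [mem_sphere_zero_iff_norm.1 u.2, mul_one] at this
  linarith

lemma int_sq_le {n : ℕ} (hn : 2 ≤ n) {K : Set (EuclideanSpace ℝ (Fin n))} (hK : IsConvexBody K)
    (hvol : vol K = vol (unitBall n)) :
    ∃ x₀ ∈ interior K, ∫ u : sphere (0 : EuclideanSpace ℝ (Fin n)) 1,
      (supp K u - ⟪x₀, (u : EuclideanSpace ℝ (Fin n))⟫) ^ (-2:ℝ) ∂(sphMeasure n)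
        ≤ ((sphMeasure n) Set.univ).toReal := by
  obtain ⟨x₀, hx, h⟩ := santalo_body (by omega) hK hvol
  refine ⟨x₀, hx, ?_⟩
  have hp := hfun_pos hK.1 hx
  have hc := hfun_cont hK.1 ⟨x₀, interior_subset hx⟩ x₀
  have i1 : Integrable (fun u : sphere (0 : EuclideanSpace ℝ (Fin n)) 1 =>
      (supp K u - ⟪x₀, (u : EuclideanSpace ℝ (Fin n))⟫) ^ (-2:ℝ)) (sphMeasure n) :=
    cont_int (hc.rpow_const fun u => Or.inl (hp u).ne')
  have i2 : Integrable (fun u : sphere (0 : EuclideanSpace ℝ (Fin n)) 1 =>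
      ((supp K u - ⟪x₀, (u : EuclideanSpace ℝ (Fin n))⟫) ^ n)⁻¹) (sphMeasure n) :=
    cont_int ((hc.pow n).inv₀ fun u => (pow_pos (hp u) n).ne')
  have m := integral_mono i1 (((integrable_const (1:ℝ))).add
    ((i2.sub (integrable_const (1:ℝ))).const_mul (2 / (n:ℝ)))) (fun u => bern hn (hp u))
  refine m.trans ?_
  simp only [Pi.add_apply]
  rw [integral_add (integrable_const _) ((i2.sub (integrable_const (1:ℝ))).const_mul _),
    integral_const_mul]
  simp only [Pi.sub_apply]
  rw [integral_sub i2 (integrable_const _)]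
  simp only [integral_const, smul_eq_mul, mul_one, Measure.real]
  have : 2 / (n:ℝ) * (∫ u : sphere (0 : EuclideanSpace ℝ (Fin n)) 1,
      ((supp K u - ⟪x₀, (u : EuclideanSpace ℝ (Fin n))⟫) ^ n)⁻¹ ∂(sphMeasure n) -
      ((sphMeasure n) Set.univ).toReal) ≤ 0 :=
    mul_nonpos_of_nonneg_of_nonpos (by positivity) (by linarith)
  linarith

lemma slice_integral {m : ℕ} (hm : 1 ≤ m) {u₀ : EuclideanSpace ℝ (Fin (m + 1))} (hu : ‖u₀‖ = 1)
    (Ψ : ℝ → ℝ → ℝ)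
    (hintA : Integrable (fun x : EuclideanSpace ℝ (Fin (m + 1)) =>
      Ψ ⟪u₀, x⟫ (√(‖x‖ ^ 2 - ⟪u₀, x⟫ ^ 2)))) :
    ∫ x : EuclideanSpace ℝ (Fin (m + 1)), Ψ ⟪u₀, x⟫ (√(‖x‖ ^ 2 - ⟪u₀, x⟫ ^ 2)) =
      ((sphMeasure m) Set.univ).toReal * ∫ b in Ioi (0:ℝ), b ^ (m - 1) * ∫ a, Ψ a b := by
  have : Nonempty (Fin m) := ⟨⟨0, hm⟩⟩
  obtain ⟨b, hb⟩ := Orthonormal.exists_orthonormalBasis_extension_of_card_eq (𝕜 := ℝ)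
    (E := EuclideanSpace ℝ (Fin (m + 1))) (ι := Fin (m + 1)) (by simp) (v := fun _ => u₀) (s := {0})
    (by
      constructor
      · intro i; simpa using hu
      · intro i j hij
        exact absurd (Subsingleton.elim i j) hij)
  have hb0 : b 0 = u₀ := hb 0 (by simp)
  let P : EuclideanSpace ℝ (Fin (m + 1)) ≃ᵐ ℝ × (Fin m → ℝ) :=
    (b.repr.toMeasurableEquiv.trans (MeasurableEquiv.toLp 2 (Fin (m + 1) → ℝ)).symm).trans
      (MeasurableEquiv.piFinSuccAbove (fun _ : Fin (m + 1) => ℝ) 0)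
  have mp : MeasurePreserving P :=
    (volume_preserving_piFinSuccAbove (fun _ : Fin (m + 1) => ℝ) 0).comp
      ((PiLp.volume_preserving_ofLp (Fin (m + 1))).comp b.repr.measurePreserving)
  have P1 : ∀ x, (P x).1 = ⟪u₀, x⟫ := by
    intro x
    rw [← hb0, ← b.repr_apply_apply]
    rfl
  have P2 : ∀ x, ‖(WithLp.toLp 2 (P x).2 : EuclideanSpace ℝ (Fin m))‖ =
      √(‖x‖ ^ 2 - ⟪u₀, x⟫ ^ 2) := by
    intro x
    have h1 : ‖x‖ ^ 2 = ∑ i, (b.repr x i) ^ 2 := by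
      rw [← b.repr.norm_map x, EuclideanSpace.real_norm_sq_eq]
    have h2 : ∀ i, (P x).2 i = b.repr x (Fin.succ i) := fun i => rfl
    rw [EuclideanSpace.norm_eq, h1, Fin.sum_univ_succ, ← P1 x]
    have h3 : (P x).1 = b.repr x 0 := rfl
    rw [h3]
    congr 1
    simp [h2]
  have e0 : (fun x : EuclideanSpace ℝ (Fin (m + 1)) => Ψ ⟪u₀, x⟫ (√(‖x‖ ^ 2 - ⟪u₀, x⟫ ^ 2))) =
      (fun p : ℝ × (Fin m → ℝ) => Ψ p.1 ‖(WithLp.toLp 2 p.2 : EuclideanSpace ℝ (Fin m))‖) ∘ P := by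
    ext x
    simp only [Function.comp_apply, P1, P2]
  rw [e0, mp.integrable_comp_emb P.measurableEmbedding] at hintA
  rw [e0]
  have e1 := mp.integral_comp P.measurableEmbedding
    (fun p : ℝ × (Fin m → ℝ) => Ψ p.1 ‖(WithLp.toLp 2 p.2 : EuclideanSpace ℝ (Fin m))‖)
  refine e1.trans ?_
  rw [Measure.volume_eq_prod] at hintA ⊢
  rw [integral_prod_symm _ hintA]
  simp only
  have e2 := (PiLp.volume_preserving_toLp (Fin m)).integral_comp
    (MeasurableEquiv.toLp 2 (Fin m → ℝ)).measurableEmbedding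
    (fun y : EuclideanSpace ℝ (Fin m) => ∫ a, Ψ a ‖y‖)
  rw [e2, integral_fun_norm_addHaar volume (fun b => ∫ a, Ψ a b), sph_total]
  rw [vol, unitBall, Measure.addHaar_closedBall_eq_addHaar_ball]
  simp [Measure.real, mul_assoc]

lemma betaInt_swap (m : ℕ) (hm : 1 ≤ m) :
    betaInt 3 m = ∫ b in (0:ℝ)..1, b ^ (m - 1) * (1 - b) ^ 2 := by
  unfold betaInt
  have e0 := intervalIntegral.integral_comp_sub_left (fun b : ℝ => b ^ (m - 1) * (1 - b) ^ 2) 1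
    (a := 0) (b := 1)
  simp only [sub_self, sub_zero] at e0
  rw [← e0]
  apply intervalIntegral.integral_congr
  intro t _
  simp only
  have e1 : (3:ℝ) - 1 = (2:ℕ) := by norm_num
  have e2 : (m:ℝ) - 1 = ((m - 1 : ℕ) : ℝ) := by rw [Nat.cast_sub hm]; simp
  rw [e1, e2, rpow_natCast, rpow_natCast]
  ring

lemma scaled_beta (m : ℕ) (hm : 1 ≤ m) {c : ℝ} (hc : 0 ≤ c) (hc1 : c ≤ 1) :
    ∫ b in Ioc (0:ℝ) 1, b ^ (m - 1) * (max (c - b) 0) ^ 2 = c ^ (m + 2) * betaInt 3 m := by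
  rw [← intervalIntegral.integral_of_le zero_le_one]
  have hcont : Continuous (fun b : ℝ => b ^ (m - 1) * (max (c - b) 0) ^ 2) := by fun_prop
  rw [← intervalIntegral.integral_add_adjacent_intervals (b := c)
    (hcont.intervalIntegrable _ _) (hcont.intervalIntegrable _ _)]
  have e2 : ∫ b in c..1, b ^ (m - 1) * (max (c - b) 0) ^ 2 = 0 := by
    apply intervalIntegral.integral_zero_ae
    refine ae_of_all _ fun b hb => ?_
    rw [uIoc_of_le hc1] at hb
    rw [max_eq_right (by linarith [hb.1])]
    simp
  rw [e2, add_zero]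
  have e3 : ∫ b in (0:ℝ)..c, b ^ (m - 1) * (max (c - b) 0) ^ 2 =
      ∫ b in (0:ℝ)..c, b ^ (m - 1) * (c - b) ^ 2 := by
    apply intervalIntegral.integral_congr
    intro b hb
    rw [uIcc_of_le hc] at hb
    simp only
    rw [max_eq_left (by linarith [hb.2])]
  rw [e3, betaInt_swap m hm]
  have e4 := intervalIntegral.smul_integral_comp_mul_left
    (fun b : ℝ => b ^ (m - 1) * (c - b) ^ 2) c (a := 0) (b := 1)
  rw [mul_zero, mul_one] at e4
  rw [← e4, smul_eq_mul, ← intervalIntegral.integral_const_mul,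
    ← intervalIntegral.integral_const_mul]
  apply intervalIntegral.integral_congr
  intro t _
  simp only
  obtain ⟨l, rfl⟩ : ∃ l, m = l + 1 := ⟨m - 1, by omega⟩
  simp only [Nat.add_sub_cancel]
  ring

/-- inner integral in the first coordinate -/
lemma inner_a {σ b : ℝ} (hσ0 : 0 ≤ σ) (hσ : σ ≤ 1) (hb : 0 < b) :
    ∫ a : ℝ, max a 0 * (max (σ * √(a ^ 2 + b ^ 2) - b) 0) ^ 2 *
      cutF (fun _ => 1) 1 (√(a ^ 2 + b ^ 2)) =
      (1/2) * ∫ q in Ioc (0:ℝ) 1, (max (σ * √q - b) 0) ^ 2 := by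
  set G : ℝ → ℝ := fun q => (max (σ * √q - b) 0) ^ 2 * cutF (fun _ => 1) 1 (√q) with hG
  have hGz : ∀ q, q ≤ b ^ 2 → G q = 0 := by
    intro q hq
    have : √q ≤ b := by
      rw [← sqrt_sq hb.le]
      exact sqrt_le_sqrt hq
    have : σ * √q ≤ b := by nlinarith [sqrt_nonneg q]
    simp only [hG]
    rw [max_eq_right (by linarith)]
    simp
  have e1 : ∫ a : ℝ, max a 0 * (max (σ * √(a ^ 2 + b ^ 2) - b) 0) ^ 2 *
      cutF (fun _ => 1) 1 (√(a ^ 2 + b ^ 2)) = ∫ a in Ioi (0:ℝ), a * G (a ^ 2 + b ^ 2) := by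
    rw [← integral_indicator measurableSet_Ioi]
    congr 1
    ext a
    by_cases ha : 0 < a
    · rw [indicator_of_mem (by exact ha), max_eq_left ha.le]
      simp only [hG]
      ring
    · rw [indicator_of_notMem (by exact ha), max_eq_right (not_lt.1 ha)]
      simp
  have e2 : ∫ a in Ioi (0:ℝ), a * G (a ^ 2 + b ^ 2) = (1/2) * ∫ y in Ioi (0:ℝ), G (y + b ^ 2) := by
    rw [← integral_comp_rpow_Ioi (fun y => G (y + b ^ 2)) (p := 2) (by norm_num),
      ← integral_const_mul]
    apply setIntegral_congr_fun measurableSet_Ioi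
    intro a _
    simp only [smul_eq_mul]
    norm_num
    ring
  have e3 : ∫ y in Ioi (0:ℝ), G (y + b ^ 2) = ∫ q in Ioi (b ^ 2), G q := by
    rw [← integral_indicator measurableSet_Ioi, ← integral_indicator measurableSet_Ioi,
      ← integral_add_right_eq_self ((Ioi (b ^ 2)).indicator fun q => G q) (b ^ 2)]
    congr 1
    ext y
    simp [indicator]
  have e4 : ∫ q in Ioi (b ^ 2), G q = ∫ q in Ioc (0:ℝ) 1, (max (σ * √q - b) 0) ^ 2 := by
    rw [← integral_indicator measurableSet_Ioi, ← integral_indicator measurableSet_Ioc]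
    congr 1
    ext q
    by_cases hq : b ^ 2 < q
    · rw [indicator_of_mem (by exact hq)]
      have hq0 : 0 < q := lt_of_le_of_lt (sq_nonneg b) hq
      by_cases hq1 : q ≤ 1
      · rw [indicator_of_mem (by exact ⟨hq0, hq1⟩)]
        have : √q ≤ 1 := by rw [sqrt_le_one]; exact hq1
        simp only [hG, cutF, this, if_true, if_false, mul_one, mul_zero]
      · rw [indicator_of_notMem (by intro h; exact hq1 h.2)]
        have : ¬ √q ≤ 1 := by rw [sqrt_le_one]; exact hq1
        simp only [hG, cutF, this, if_true, if_false, mul_one, mul_zero]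
    · rw [indicator_of_notMem (by exact hq)]
      by_cases hm : q ∈ Ioc (0:ℝ) 1
      · rw [indicator_of_mem hm]
        have h1 := hGz q (not_lt.1 hq)
        have : √q ≤ 1 := by rw [sqrt_le_one]; exact hm.2
        simp only [hG, cutF, this, if_true, mul_one] at h1
        exact h1.symm
      · rw [indicator_of_notMem hm]
  rw [e1, e2, e3, e4]

lemma double_int (m : ℕ) (hm : 1 ≤ m) {σ : ℝ} (hσ0 : 0 ≤ σ) (hσ : σ ≤ 1) :
    ∫ b in Ioi (0:ℝ), b ^ (m - 1) * ((1/2) * ∫ q in Ioc (0:ℝ) 1, (max (σ * √q - b) 0) ^ 2) =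
      σ ^ (m + 2) * betaInt 3 m / (m + 4) := by
  have e1 : ∫ b in Ioi (0:ℝ), b ^ (m - 1) * ((1/2) * ∫ q in Ioc (0:ℝ) 1, (max (σ * √q - b) 0) ^ 2)
      = ∫ b in Ioc (0:ℝ) 1, ∫ q in Ioc (0:ℝ) 1, (1/2) * (b ^ (m - 1) * (max (σ * √q - b) 0) ^ 2) := by
    rw [← integral_indicator measurableSet_Ioi, ← integral_indicator measurableSet_Ioc]
    congr 1
    ext b
    by_cases hb : 0 < b
    · rw [indicator_of_mem (by exact hb)]
      by_cases hb1 : b ≤ 1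
      · rw [indicator_of_mem (by exact ⟨hb, hb1⟩), integral_const_mul, integral_const_mul]
        ring
      · rw [indicator_of_notMem (by intro h; exact hb1 h.2)]
        have : ∫ q in Ioc (0:ℝ) 1, (max (σ * √q - b) 0) ^ 2 = 0 := by
          apply setIntegral_eq_zero_of_forall_eq_zero
          intro q hq
          have h1 : √q ≤ 1 := by rw [sqrt_le_one]; exact hq.2
          have : σ * √q ≤ 1 := by nlinarith [sqrt_nonneg q]
          rw [max_eq_right (by linarith)]
          simp
        rw [this]
        simp
    · rw [indicator_of_notMem (by exact hb), indicator_of_notMem (by intro h; exact hb h.1)]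
  rw [e1, integral_integral_swap]
  · simp_rw [integral_const_mul]
    have e2 : ∫ q in Ioc (0:ℝ) 1, (∫ b in Ioc (0:ℝ) 1, b ^ (m - 1) * (max (σ * √q - b) 0) ^ 2) =
        ∫ q in Ioc (0:ℝ) 1, (σ ^ (m + 2) * betaInt 3 m) * q ^ (((m:ℝ) + 2) / 2) := by
      apply setIntegral_congr_fun measurableSet_Ioc
      intro q hq
      simp only
      have h1 : √q ≤ 1 := by rw [sqrt_le_one]; exact hq.2
      rw [scaled_beta m hm (mul_nonneg hσ0 (sqrt_nonneg _)) (by nlinarith [sqrt_nonneg q]), mul_pow]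
      have : √q ^ (m + 2) = q ^ (((m:ℝ) + 2) / 2) := by
        rw [sqrt_eq_rpow, ← rpow_natCast, ← rpow_mul hq.1.le]
        congr 1
        push_cast
        ring
      rw [this]
      ring
    rw [e2, integral_const_mul, ← intervalIntegral.integral_of_le zero_le_one, integral_rpow]
    · rw [one_rpow, zero_rpow (by positivity)]
      field_simp
      ring
    · left
      have : (0:ℝ) ≤ m := Nat.cast_nonneg m
      linarith
  · have hc : Continuous (fun p : ℝ × ℝ => (1/2) * (p.1 ^ (m - 1) * (max (σ * √p.2 - p.1) 0) ^ 2)) := by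
      fun_prop
    have hi : IntegrableOn (fun p : ℝ × ℝ => (1/2) * (p.1 ^ (m - 1) * (max (σ * √p.2 - p.1) 0) ^ 2))
        (Icc (0:ℝ) 1 ×ˢ Icc (0:ℝ) 1) :=
      hc.continuousOn.integrableOn_compact (isCompact_Icc.prod isCompact_Icc)
    have := hi.mono_set (prod_mono (Ioc_subset_Icc_self (a := (0:ℝ)) (b := 1))
      (Ioc_subset_Icc_self (a := (0:ℝ)) (b := 1)))
    rw [IntegrableOn, Measure.volume_eq_prod, ← Measure.prod_restrict] at this
    exact this

/-- zonal integral on the sphere -/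
lemma zonal {m : ℕ} (hm : 1 ≤ m) {u₀ : EuclideanSpace ℝ (Fin (m + 1))} (hu : ‖u₀‖ = 1)
    {σ : ℝ} (hσ0 : 0 ≤ σ) (hσ : σ ≤ 1) :
    ∫ u : sphere (0 : EuclideanSpace ℝ (Fin (m + 1))) 1,
      max ⟪u₀, (u : EuclideanSpace ℝ (Fin (m + 1)))⟫ 0 *
        (max (σ - √(1 - ⟪u₀, (u : EuclideanSpace ℝ (Fin (m + 1)))⟫ ^ 2)) 0) ^ 2 ∂(sphMeasure (m + 1))
      = ((sphMeasure m) Set.univ).toReal * betaInt 3 m * σ ^ (m + 2) := by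
  set Ψ : ℝ → ℝ → ℝ := fun a b => max a 0 * (max (σ * √(a ^ 2 + b ^ 2) - b) 0) ^ 2 *
      cutF (fun _ => 1) 1 (√(a ^ 2 + b ^ 2)) with hΨ
  set k : EuclideanSpace ℝ (Fin (m + 1)) → ℝ := fun x => max ⟪u₀, x⟫ 0 *
    (max (σ * ‖x‖ - √(‖x‖ ^ 2 - ⟪u₀, x⟫ ^ 2)) 0) ^ 2 with hk
  have hkc : Continuous k := by fun_prop
  have hsq : ∀ x : EuclideanSpace ℝ (Fin (m + 1)), 0 ≤ ‖x‖ ^ 2 - ⟪u₀, x⟫ ^ 2 := by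
    intro x
    have := abs_real_inner_le_norm u₀ x
    rw [hu, one_mul] at this
    have := sq_le_sq' (neg_le_of_abs_le this) (le_of_abs_le this)
    linarith
  have hΨk : ∀ x, Ψ ⟪u₀, x⟫ (√(‖x‖ ^ 2 - ⟪u₀, x⟫ ^ 2)) = k x * cutF (fun _ => 1) 1 ‖x‖ := by
    intro x
    simp only [hΨ, hk]
    rw [sq_sqrt (hsq x), add_sub_cancel, sqrt_sq (norm_nonneg x)]
  have nice := nice_cut (n := m + 1) continuous_norm (c := 1) one_pos (fun x => by rw [one_mul])
    (φ := fun _ => (1:ℝ)) continuous_const (fun _ => zero_le_one) (fun _ => le_rfl) 1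
  have hintA := nice.integrable_mul hkc (volume : Measure (EuclideanSpace ℝ (Fin (m + 1))))
  have p1 := polar_hom (volume : Measure (EuclideanSpace ℝ (Fin (m + 1)))) (n := m + 1) (by simp) 3
    (k := k) (h := fun x => ‖x‖) (F := cutF (fun _ => 1) 1) hintA
    (by
      intro r hr u _
      simp only [hk]
      rw [inner_smul_right, norm_smul, Real.norm_of_nonneg hr.le]
      have e1 : max (r * ⟪u₀, u⟫) 0 = r * max ⟪u₀, u⟫ 0 := by
        rw [mul_max_of_nonneg _ _ hr.le, mul_zero]
      have e2 : √((r * ‖u‖) ^ 2 - (r * ⟪u₀, u⟫) ^ 2) = r * √(‖u‖ ^ 2 - ⟪u₀, u⟫ ^ 2) := by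
        rw [mul_pow, mul_pow, ← mul_sub, sqrt_mul (sq_nonneg r), sqrt_sq hr.le]
      have e3 : σ * (r * ‖u‖) - r * √(‖u‖ ^ 2 - ⟪u₀, u⟫ ^ 2) =
        r * (σ * ‖u‖ - √(‖u‖ ^ 2 - ⟪u₀, u⟫ ^ 2)) := by ring
      have e4 : max (r * (σ * ‖u‖ - √(‖u‖ ^ 2 - ⟪u₀, u⟫ ^ 2))) 0 =
        r * max (σ * ‖u‖ - √(‖u‖ ^ 2 - ⟪u₀, u⟫ ^ 2)) 0 := by
        rw [mul_max_of_nonneg _ _ hr.le, mul_zero]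
      rw [e1, e2, e3, e4]
      ring)
    (by intro r hr u hu; rw [norm_smul, Real.norm_of_nonneg hr.le])
    (by intro u hu; rw [mem_sphere_zero_iff_norm.1 hu]; norm_num)
  have p2 := slice_integral hm hu Ψ (by
    simp_rw [hΨk]
    exact hintA)
  simp_rw [hΨk] at p2
  rw [p2, cut_one_integral] at p1
  have p3 : ∫ b in Ioi (0:ℝ), b ^ (m - 1) * ∫ a, Ψ a b = σ ^ (m + 2) * betaInt 3 m / (m + 4) := by
    rw [← double_int m hm hσ0 hσ]
    apply setIntegral_congr_fun measurableSet_Ioi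
    intro b hb
    simp only [hΨ]
    rw [inner_a hσ0 hσ hb]
  rw [p3] at p1
  have e5 : ∫ u : sphere (0 : EuclideanSpace ℝ (Fin (m + 1))) 1,
      max ⟪u₀, (u : EuclideanSpace ℝ (Fin (m + 1)))⟫ 0 *
        (max (σ - √(1 - ⟪u₀, (u : EuclideanSpace ℝ (Fin (m + 1)))⟫ ^ 2)) 0) ^ 2 ∂(sphMeasure (m + 1))
      = ∫ u : sphere (0 : EuclideanSpace ℝ (Fin (m + 1))) 1,
        k u * (‖(u : EuclideanSpace ℝ (Fin (m + 1)))‖ ^ (m + 1 + 3))⁻¹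
          ∂(volume : Measure (EuclideanSpace ℝ (Fin (m + 1)))).toSphere := by
    unfold sphMeasure
    congr 1
    ext u
    simp only [hk]
    rw [mem_sphere_zero_iff_norm.1 u.2]
    simp
  rw [e5]
  set I := ∫ u : sphere (0 : EuclideanSpace ℝ (Fin (m + 1))) 1,
        k u * (‖(u : EuclideanSpace ℝ (Fin (m + 1)))‖ ^ (m + 1 + 3))⁻¹
          ∂(volume : Measure (EuclideanSpace ℝ (Fin (m + 1)))).toSphere
  have hm4 : (((m + 1 - 1 + 3 : ℕ) : ℝ) + 1) = m + 4 := by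
    rw [Nat.add_sub_cancel]; push_cast; ring
  rw [hm4] at p1
  have : (m:ℝ) + 4 ≠ 0 := by positivity
  field_simp at p1
  linarith

lemma betaInt_eq {a b : ℝ} (ha : 0 < a) (hb : 0 < b) : betaInt a b = ProbabilityTheory.beta a b := by
  rw [ProbabilityTheory.beta_eq_betaIntegralReal a b ha hb]
  have : Complex.betaIntegral a b = ((betaInt a b : ℝ) : ℂ) := by
    unfold Complex.betaIntegral betaInt
    rw [← intervalIntegral.integral_ofReal]
    apply intervalIntegral.integral_congr
    intro x hx
    rw [uIcc_of_le zero_le_one] at hx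
    simp only
    rw [Complex.ofReal_mul, Complex.ofReal_cpow hx.1, Complex.ofReal_cpow (by linarith [hx.2])]
    push_cast
    rfl
  rw [this, Complex.ofReal_re]

lemma sph_gamma {n : ℕ} (hn : 1 ≤ n) :
    ((sphMeasure n) Set.univ).toReal = 2 * √π ^ n / Gamma (n / 2) := by
  have : Nonempty (Fin n) := ⟨⟨0, hn⟩⟩
  rw [sph_total, vol, unitBall, EuclideanSpace.volume_closedBall]
  have hn0 : (0:ℝ) < n := by exact_mod_cast hn
  have hG : 0 < Gamma ((n:ℝ) / 2) := Gamma_pos_of_pos (by positivity)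
  have hG1 : Gamma ((n:ℝ) / 2 + 1) = n / 2 * Gamma ((n:ℝ) / 2) := Gamma_add_one (by positivity)
  simp only [ENNReal.ofReal_one, one_pow, one_mul, Fintype.card_fin]
  rw [ENNReal.toReal_ofReal (by rw [hG1]; positivity), hG1]
  field_simp

lemma alpha_eq {m : ℕ} (hm : 1 ≤ m) :
    alphaConst (m + 1) = ((sphMeasure m) Set.univ).toReal * betaInt 3 m := by
  have hm0 : (0:ℝ) < m := by exact_mod_cast hm
  unfold alphaConst
  rw [← sph_total, sph_gamma (by omega), sph_gamma hm]
  have e : ((m + 1 : ℕ) : ℝ) - 1 = m := by push_cast; ring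
  rw [e, betaInt_eq (a := 1/2) (by norm_num) (by positivity), ProbabilityTheory.beta, Gamma_one_half_eq]
  have e2 : (1:ℝ) / 2 + m / 2 = ((m + 1 : ℕ) : ℝ) / 2 := by push_cast; ring
  rw [e2]
  have hG : 0 < Gamma ((m:ℝ) / 2) := Gamma_pos_of_pos (by positivity)
  have hG2 : 0 < Gamma (((m + 1 : ℕ) : ℝ) / 2) := Gamma_pos_of_pos (by positivity)
  have hpi : 0 < √π := sqrt_pos.2 pi_pos
  field_simp
  ring_nf

lemma alpha_pos {m : ℕ} (hm : 1 ≤ m) : 0 < alphaConst (m + 1) := by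
  have hm0 : (0:ℝ) < m := by exact_mod_cast hm
  rw [alpha_eq hm, betaInt_eq (by norm_num) hm0]
  exact mul_pos (sph_pos hm) (ProbabilityTheory.beta_pos (by norm_num) hm0)

lemma trig_ineq {s c t v : ℝ} (h1 : t ^ 2 + v ^ 2 = 1) (h2 : s ^ 2 + c ^ 2 = 1) (hv : 0 ≤ v)
    (hvs : v ≤ s) (ht : 0 ≤ t) (hc : 0 ≤ c) : s - v ≤ s * t - c * v := by
  have hct : c ≤ t := by
    apply le_of_sq_le_sq _ ht
    nlinarith
  have h3 : s * (1 - t) * ((1 + t) * (1 + c)) ≤ v * (1 - c) * ((1 + t) * (1 + c)) := by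
    have e1 : s * (1 - t) * ((1 + t) * (1 + c)) = (v * s) * (v * (1 + c)) := by
      have : (1 - t) * (1 + t) = v ^ 2 := by linarith
      calc _ = s * ((1 - t) * (1 + t)) * (1 + c) := by ring
        _ = _ := by rw [this]; ring
    have e2 : v * (1 - c) * ((1 + t) * (1 + c)) = (v * s) * (s * (1 + t)) := by
      have : (1 - c) * (1 + c) = s ^ 2 := by linarith
      calc _ = v * ((1 - c) * (1 + c)) * (1 + t) := by ring
        _ = _ := by rw [this]; ring
    rw [e1, e2]
    apply mul_le_mul_of_nonneg_left _ (mul_nonneg hv (hv.trans hvs))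
    exact mul_le_mul hvs (by linarith) (by linarith) (hv.trans hvs)
  have := le_of_mul_le_mul_right h3 (by positivity)
  linarith

set_option maxHeartbeats 1000000 in
lemma vitale_pw {m : ℕ} {K L : Set (EuclideanSpace ℝ (Fin m))} (hK : IsCompact K)
    (hL : IsCompact L) (hLn : L.Nonempty) {D σ δ : ℝ}
    (hD : ∀ x ∈ K, ∀ y ∈ L, ‖x - y‖ ≤ D) {u₀ y : EuclideanSpace ℝ (Fin m)} (hu₀ : ‖u₀‖ = 1)
    (hy : y ∈ K) (hA : ∀ z ∈ L, δ ≤ ⟪u₀, y - z⟫) (hδ : 0 < δ) (hD0 : 0 < D) (hσ0 : 0 ≤ σ)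
    (hσ1 : σ ≤ 1) (hδσ : δ = D * σ) (u : EuclideanSpace ℝ (Fin m)) (hu1 : ‖u‖ = 1) :
      D ^ 2 * (max ⟪u₀, u⟫ 0 * (max (σ - √(1 - ⟪u₀, u⟫ ^ 2)) 0) ^ 2)
      ≤ (supp K u - supp L u) ^ 2 := by
  set t := ⟪u₀, u⟫ with ht
  rcases le_or_gt t 0 with ht0 | ht0
  · rw [max_eq_right ht0]; simp; positivity
  rcases le_or_gt σ (√(1 - t ^ 2)) with hs | hs
  · rw [max_eq_right (a := σ - _) (by linarith)]; simp; positivity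
  rw [max_eq_left ht0.le, max_eq_left (by linarith)]
  have ht1 : t ≤ 1 := by
    have := real_inner_le_norm u₀ u
    rwa [hu₀, hu1, one_mul] at this
  have hv2 : √(1 - t ^ 2) ^ 2 = 1 - t ^ 2 := sq_sqrt (by nlinarith)
  have hv0 := sqrt_nonneg (1 - t ^ 2)
  set v := √(1 - t ^ 2)
  have hc2 : √(1 - σ ^ 2) ^ 2 = 1 - σ ^ 2 := sq_sqrt (by nlinarith)
  have hc0 := sqrt_nonneg (1 - σ ^ 2)
  set c := √(1 - σ ^ 2)
  have htrig := trig_ineq (s := σ) (c := c) (t := t) (v := v) (by linarith) (by linarith) hv0 hs.le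
    ht0.le hc0
  obtain ⟨z, hz, hzs⟩ := exists_supp hL hLn u
  have hg : ⟪y - z, u⟫ ≤ supp K u - supp L u := by
    rw [inner_sub_left]
    linarith [le_supp hK u hy]
  set w := y - z
  set A := ⟪u₀, w⟫ with hAd
  have hAδ : δ ≤ A := hA z hz
  have hu0u0 : ⟪u₀, u₀⟫ = 1 := by rw [real_inner_self_eq_norm_sq, hu₀]; norm_num
  have hww : ⟪w, w⟫ = ‖w‖ ^ 2 := real_inner_self_eq_norm_sq w
  have huu : ⟪u, u⟫ = 1 := by rw [real_inner_self_eq_norm_sq, hu1]; norm_num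
  have hwu0 : ⟪w, u₀⟫ = A := real_inner_comm _ _
  have huu0 : ⟪u, u₀⟫ = t := real_inner_comm _ _
  have n1 : ‖w - A • u₀‖ ^ 2 = ‖w‖ ^ 2 - A ^ 2 := by
    rw [← real_inner_self_eq_norm_sq]
    simp only [inner_sub_left, inner_sub_right, inner_smul_left, inner_smul_right, conj_trivial,
      hu0u0, hww, hwu0, ← hAd]
    ring
  have n2 : ‖u - t • u₀‖ ^ 2 = 1 - t ^ 2 := by
    rw [← real_inner_self_eq_norm_sq]
    simp only [inner_sub_left, inner_sub_right, inner_smul_left, inner_smul_right, conj_trivial,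
      hu0u0, huu, huu0, ← ht]
    ring
  have n3 : ⟪w - A • u₀, u - t • u₀⟫ = ⟪w, u⟫ - A * t := by
    simp only [inner_sub_left, inner_sub_right, inner_smul_left, inner_smul_right, conj_trivial,
      hu0u0, hwu0, ← ht]
    ring
  have hwD : ‖w‖ ≤ D := hD y hy z hz
  have b1 : ‖w - A • u₀‖ ≤ D * c := by
    apply le_of_sq_le_sq _ (by positivity)
    rw [n1, mul_pow, hc2]
    have : ‖w‖ ^ 2 ≤ D ^ 2 := pow_le_pow_left₀ (norm_nonneg _) hwD 2
    have : δ ^ 2 ≤ A ^ 2 := pow_le_pow_left₀ hδ.le hAδ 2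
    rw [hδσ] at this
    nlinarith
  have b2 : ‖u - t • u₀‖ ≤ v := by
    apply le_of_sq_le_sq _ hv0
    rw [n2, hv2]
  have b3 : -(D * c * v) ≤ ⟪w, u⟫ - A * t := by
    rw [← n3]
    have := neg_le_of_abs_le (abs_real_inner_le_norm (w - A • u₀) (u - t • u₀))
    have h4 : ‖w - A • u₀‖ * ‖u - t • u₀‖ ≤ D * c * v :=
      mul_le_mul b1 b2 (norm_nonneg _) (by positivity)
    linarith
  have b4 : D * (σ - v) ≤ supp K u - supp L u := by
    have h5 : D * (σ - v) ≤ D * (σ * t - c * v) := mul_le_mul_of_nonneg_left htrig hD0.le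
    have h6 : D * σ * t ≤ A * t := mul_le_mul_of_nonneg_right (hδσ ▸ hAδ) ht0.le
    nlinarith
  have b5 : (D * (σ - v)) ^ 2 ≤ (supp K u - supp L u) ^ 2 :=
    pow_le_pow_left₀ (mul_nonneg hD0.le (by linarith)) b4 2
  refine le_trans ?_ b5
  rw [mul_pow]
  apply mul_le_mul_of_nonneg_left _ (sq_nonneg D)
  nlinarith [sq_nonneg (σ - v)]

set_option maxHeartbeats 1000000 in
lemma vitale {m : ℕ} (hm : 1 ≤ m) {K L : Set (EuclideanSpace ℝ (Fin (m + 1)))} (hK : IsCompact K)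
    (hKn : K.Nonempty) (hL : IsCompact L) (hLn : L.Nonempty) {D : ℝ}
    (hD : ∀ x ∈ K, ∀ y ∈ L, ‖x - y‖ ≤ D) {u₀ : EuclideanSpace ℝ (Fin (m + 1))} (hu₀ : ‖u₀‖ = 1)
    (hδ : 0 < supp K u₀ - supp L u₀) :
    alphaConst (m + 1) * (supp K u₀ - supp L u₀) ^ (m + 2) ≤
      D ^ m * ∫ u : sphere (0 : EuclideanSpace ℝ (Fin (m + 1))) 1, (supp K u - supp L u) ^ 2
        ∂(sphMeasure (m + 1)) := by
  set δ := supp K u₀ - supp L u₀ with hδd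
  obtain ⟨y, hy, hys⟩ := exists_supp hK hKn u₀
  have hA : ∀ z ∈ L, δ ≤ ⟪u₀, y - z⟫ := by
    intro z hz
    have := le_supp hL u₀ hz
    rw [real_inner_comm, inner_sub_left]
    linarith
  have hδD : δ ≤ D := by
    obtain ⟨z, hz⟩ := hLn
    refine (hA z hz).trans ((real_inner_le_norm _ _).trans ?_)
    rw [hu₀, one_mul]
    exact hD y hy z hz
  have hD0 : 0 < D := hδ.trans_le hδD
  set σ := δ / D with hσ
  have hσ0 : 0 ≤ σ := by positivity
  have hσ1 : σ ≤ 1 := (div_le_one hD0).2 hδD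
  have hδσ : δ = D * σ := by rw [hσ]; field_simp
  have pw : ∀ u : sphere (0 : EuclideanSpace ℝ (Fin (m + 1))) 1,
      D ^ 2 * (max ⟪u₀, (u : EuclideanSpace ℝ (Fin (m + 1)))⟫ 0 *
        (max (σ - √(1 - ⟪u₀, (u : EuclideanSpace ℝ (Fin (m + 1)))⟫ ^ 2)) 0) ^ 2)
      ≤ (supp K u - supp L u) ^ 2 :=  fun u => vitale_pw hK hL hLn hD hu₀ hy hA hδ hD0 hσ0 hσ1 hδσ u
      (mem_sphere_zero_iff_norm.1 u.2)
  have kc : Continuous (fun u : sphere (0 : EuclideanSpace ℝ (Fin (m + 1))) 1 =>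
      D ^ 2 * (max ⟪u₀, (u : EuclideanSpace ℝ (Fin (m + 1)))⟫ 0 *
        (max (σ - √(1 - ⟪u₀, (u : EuclideanSpace ℝ (Fin (m + 1)))⟫ ^ 2)) 0) ^ 2)) := by fun_prop
  have gc : Continuous (fun u : sphere (0 : EuclideanSpace ℝ (Fin (m + 1))) 1 =>
      (supp K u - supp L u) ^ 2) := 
    (((supp_continuous hK hKn).comp continuous_subtype_val).sub
      ((supp_continuous hL hLn).comp continuous_subtype_val)).pow 2
  have hmono := integral_mono (cont_int kc) (cont_int gc) pw
  rw [integral_const_mul, zonal hm hu₀ hσ0 hσ1, ← alpha_eq hm] at hmono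
  have h7 := mul_le_mul_of_nonneg_left hmono (pow_nonneg hD0.le m)
  refine le_trans (le_of_eq ?_) h7
  rw [hδσ]
  ring

lemma alpha_one : alphaConst 1 = 0 := by
  have : betaInt 3 (((1:ℕ):ℝ) - 1) = 0 := by
    unfold betaInt
    apply intervalIntegral.integral_undef
    intro h
    have h2 : IntervalIntegrable (fun t : ℝ => -(t ^ ((3:ℝ) - 1) * (1 - t) ^ (((1:ℕ):ℝ) - 1 - 1) + (1 + t))) volume 0 1 :=
      (h.add (by apply Continuous.intervalIntegrable; fun_prop)).neg
    have h3 : IntervalIntegrable (fun t : ℝ => (t - 1)⁻¹) volume 0 1 := by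
      refine h2.congr_uIoo ?_
      intro t ht
      rw [uIoo_of_le zero_le_one] at ht
      have e1 : (3:ℝ) - 1 = (2:ℕ) := by norm_num
      have e2 : ((1:ℕ):ℝ) - 1 - 1 = -1 := by norm_num
      simp only
      rw [e1, e2, rpow_natCast, rpow_neg_one]
      have a : 1 - t ≠ 0 := by linarith [ht.2]
      have b : t - 1 ≠ 0 := by linarith [ht.2]
      have : t - 1 = -(1 - t) := by ring
      rw [this, inv_neg]
      field_simp
      ring
    rw [intervalIntegrable_sub_inv_iff] at h3
    simp at h3
  unfold alphaConst
  rw [this]; simp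

lemma sph_odd {n : ℕ} (hn : 1 ≤ n) (v : EuclideanSpace ℝ (Fin n)) :
    ∫ u : sphere (0 : EuclideanSpace ℝ (Fin n)) 1, ⟪v, (u : EuclideanSpace ℝ (Fin n))⟫
      ∂(sphMeasure n) = 0 := by
  have : Nonempty (Fin n) := ⟨⟨0, hn⟩⟩
  have nice := nice_cut (n := n) (h := fun x => ‖x‖) continuous_norm one_pos (fun x => by simp)
    (φ := fun _ => (1:ℝ)) continuous_const (by simp) (by simp) 1
  have key := polar_hom (volume : Measure (EuclideanSpace ℝ (Fin n))) (n := n) (by simp) 1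
    (k := fun x => ⟪v, x⟫) (h := fun x => ‖x‖) (F := cutF (fun _ => 1) 1)
    (nice.integrable_mul (by fun_prop) _)
    (by intro r hr u hu; simp [inner_smul_right])
    (by intro r hr u hu; simp [norm_smul, abs_of_pos hr])
    (by intro u hu; rw [mem_sphere_zero_iff_norm.1 hu]; exact one_pos)
  have hz : ∫ x : EuclideanSpace ℝ (Fin n), ⟪v, x⟫ * cutF (fun _ => 1) 1 ‖x‖ = 0 := by
    have h := integral_neg_eq_self (fun x : EuclideanSpace ℝ (Fin n) =>
      ⟪v, x⟫ * cutF (fun _ => 1) 1 ‖x‖) volume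
    simp only [inner_neg_right, norm_neg, neg_mul, integral_neg] at h
    linarith
  rw [hz, cut_one_integral] at key
  have h2 : ∀ u : sphere (0 : EuclideanSpace ℝ (Fin n)) 1,
      ⟪v, (u : EuclideanSpace ℝ (Fin n))⟫ * (‖(u : EuclideanSpace ℝ (Fin n))‖ ^ (n + 1))⁻¹
        = ⟪v, (u : EuclideanSpace ℝ (Fin n))⟫ := by
    intro u; rw [mem_sphere_zero_iff_norm.1 u.2]; simp
  simp only [h2] at key
  rcases mul_eq_zero.1 key.symm with h | h
  · exfalso
    have : (0:ℝ) < 1 / (((n - 1 + 1 : ℕ) : ℝ) + 1) := by positivity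
    linarith
  · exact h

lemma E1_ball {K : Set (EuclideanSpace ℝ (Fin 1))} (hK : IsConvexBody K)
    (hvol : vol K = vol (unitBall 1)) : ∃ c, K = closedBall c 1 := by
  obtain ⟨hKc, hKx, a, ha⟩ := hK
  have hne : K.Nonempty := ⟨a, interior_subset ha⟩
  have nrm : ∀ x : EuclideanSpace ℝ (Fin 1), ‖x‖ = |x 0| := by
    intro x; rw [EuclideanSpace.norm_eq]; simp [sqrt_sq_eq_abs]
  set f : EuclideanSpace ℝ (Fin 1) → ℝ := fun x => x 0 with hf
  have fc : Continuous f := by fun_prop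
  obtain ⟨p, hp, hpm⟩ := hKc.exists_isMinOn hne fc.continuousOn
  obtain ⟨q, hq, hqm⟩ := hKc.exists_isMaxOn hne fc.continuousOn
  have hpq : p 0 ≤ q 0 := hpm hq
  have eqx : ∀ x y : EuclideanSpace ℝ (Fin 1), x 0 = y 0 → x = y := by
    intro x y h; ext i; fin_cases i; exact h
  set c : EuclideanSpace ℝ (Fin 1) := (1/2 : ℝ) • (p + q) with hc
  have c0 : c 0 = (p 0 + q 0) / 2 := by simp [hc]; ring
  have hball : K = closedBall c ((q 0 - p 0) / 2) := by
    ext x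
    rw [mem_closedBall, dist_eq_norm, nrm, abs_le]
    simp only [PiLp.sub_apply, c0]
    constructor
    · intro hx
      have h1 : p 0 ≤ x 0 := hpm hx
      have h2 : x 0 ≤ q 0 := hqm hx
      constructor <;> linarith
    · rintro ⟨h1, h2⟩
      rcases hpq.eq_or_lt with he | hlt
      · rw [eqx x p (by linarith)]; exact hp
      have : x = ((q 0 - x 0) / (q 0 - p 0)) • p + ((x 0 - p 0) / (q 0 - p 0)) • q := by
        apply eqx
        have : q 0 - p 0 ≠ 0 := by linarith
        simp
        field_simp
        ring
      rw [this]
      have hd : 0 < q 0 - p 0 := by linarith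
      apply hKx hp hq
      · apply div_nonneg <;> linarith
      · apply div_nonneg <;> linarith
      · field_simp; ring
  refine ⟨c, ?_⟩
  have hρ : (q 0 - p 0) / 2 = 1 := by
    have h0 : 0 ≤ (q 0 - p 0) / 2 := by linarith
    rw [hball] at hvol
    unfold vol unitBall at hvol
    rw [Measure.addHaar_closedBall _ _ h0, Measure.addHaar_closedBall _ _ zero_le_one] at hvol
    have hb : 0 < (volume (ball (0 : EuclideanSpace ℝ (Fin 1)) 1)).toReal :=
      ENNReal.toReal_pos (measure_ball_pos _ _ one_pos).ne' measure_ball_lt_top.ne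
    rw [ENNReal.toReal_mul, ENNReal.toReal_mul, ENNReal.toReal_ofReal (by positivity),
      ENNReal.toReal_ofReal (by positivity)] at hvol
    have := mul_right_cancel₀ hb.ne' hvol
    simpa using this
  rw [hball, hρ]

lemma one_dim {K : Set (EuclideanSpace ℝ (Fin 1))} (hK : IsConvexBody K)
    (hvol : vol K = vol (unitBall 1))
    {e₂ : EuclideanSpace ℝ (Fin 1)} (he₂ : e₂ ∈ interior K)
    (he₂min : ∀ x ∈ interior K,
      (∫ u, (supp K u - ⟪e₂, (u : EuclideanSpace ℝ (Fin 1))⟫) ^ (-2 : ℝ) ∂(sphMeasure 1))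
        ≤ ∫ u, (supp K u - ⟪x, (u : EuclideanSpace ℝ (Fin 1))⟫) ^ (-2 : ℝ) ∂(sphMeasure 1)) :
    ∀ u : sphere (0 : EuclideanSpace ℝ (Fin 1)) 1,
      supp K u - ⟪e₂, (u : EuclideanSpace ℝ (Fin 1))⟫ = 1 := by
  obtain ⟨c, hc⟩ := E1_ball hK hvol
  have hne : K.Nonempty := ⟨e₂, interior_subset he₂⟩
  have hs : ∀ u : sphere (0 : EuclideanSpace ℝ (Fin 1)) 1,
      supp K u - ⟪c, (u : EuclideanSpace ℝ (Fin 1))⟫ = 1 := by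
    intro u
    rw [← supp_translate hK.1 hne]
    have : (fun x => x - c) '' K = closedBall 0 1 := by
      rw [hc]
      ext x
      simp only [mem_image, mem_closedBall, dist_eq_norm, sub_zero]
      constructor
      · rintro ⟨y, hy, rfl⟩; exact hy
      · intro hx; exact ⟨x + c, by simpa using hx, by simp⟩
    rw [this, supp_ball zero_le_one (mem_sphere_zero_iff_norm.1 u.2)]
  have hci : c ∈ interior K := by
    rw [hc]; exact ball_subset_interior_closedBall (mem_ball_self one_pos)
  have h := he₂min c hci
  simp only [hs, one_rpow] at h
  set v := c - e₂ with hv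
  have hh : ∀ u : sphere (0 : EuclideanSpace ℝ (Fin 1)) 1,
      supp K u - ⟪e₂, (u : EuclideanSpace ℝ (Fin 1))⟫ = 1 + ⟪v, (u : EuclideanSpace ℝ (Fin 1))⟫ := by
    intro u
    rw [hv, inner_sub_left]
    linarith [hs u]
  have hsq : ∀ u : sphere (0 : EuclideanSpace ℝ (Fin 1)) 1,
      ⟪v, (u : EuclideanSpace ℝ (Fin 1))⟫ ^ 2 = ‖v‖ ^ 2 := by
    intro u
    have hu := mem_sphere_zero_iff_norm.1 u.2
    have : ‖(u : EuclideanSpace ℝ (Fin 1))‖ ^ 2 = 1 := by rw [hu]; norm_num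
    rw [EuclideanSpace.norm_sq_eq] at this ⊢
    simp only [Fin.sum_univ_one, norm_eq_abs, sq_abs, PiLp.inner_apply, RCLike.inner_apply,
      conj_trivial] at this ⊢
    rw [mul_pow, this, one_mul]
  have hv1 : ‖v‖ ≤ 1 := by
    have := interior_subset he₂
    rw [hc, mem_closedBall, dist_comm, dist_eq_norm] at this
    exact this
  have hpt : ∀ u : sphere (0 : EuclideanSpace ℝ (Fin 1)) 1,
      1 - 2 * ⟪v, (u : EuclideanSpace ℝ (Fin 1))⟫ + ‖v‖ ^ 2 ≤
        (supp K u - ⟪e₂, (u : EuclideanSpace ℝ (Fin 1))⟫) ^ (-2 : ℝ) := by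
    intro u
    have hpos := hfun_pos hK.1 he₂ u
    have h2 := hsq u
    rw [hh u] at hpos ⊢
    set t := ⟪v, (u : EuclideanSpace ℝ (Fin 1))⟫
    rw [rpow_neg hpos.le, rpow_ofNat, ← h2, ← one_div, le_div_iff₀ (by positivity)]
    have ht : t ^ 2 ≤ 1 := by rw [h2]; exact pow_le_one₀ (norm_nonneg _) hv1
    nlinarith [sq_nonneg t]
  have hcont := hfun_cont hK.1 hne e₂
  have hI : Integrable (fun u : sphere (0 : EuclideanSpace ℝ (Fin 1)) 1 =>
      (supp K u - ⟪e₂, (u : EuclideanSpace ℝ (Fin 1))⟫) ^ (-2 : ℝ)) (sphMeasure 1) :=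
    cont_int (hcont.rpow_const (fun u => Or.inl (hfun_pos hK.1 he₂ u).ne'))
  have hci2 : Continuous (fun u : sphere (0 : EuclideanSpace ℝ (Fin 1)) 1 =>
      2 * ⟪v, (u : EuclideanSpace ℝ (Fin 1))⟫) := by fun_prop
  have hci3 : Continuous (fun u : sphere (0 : EuclideanSpace ℝ (Fin 1)) 1 =>
      1 - 2 * ⟪v, (u : EuclideanSpace ℝ (Fin 1))⟫) := by fun_prop
  have hci4 : Continuous (fun u : sphere (0 : EuclideanSpace ℝ (Fin 1)) 1 =>
      1 - 2 * ⟪v, (u : EuclideanSpace ℝ (Fin 1))⟫ + ‖v‖ ^ 2) := by fun_prop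
  have hJ := cont_int hci4
  have hm := integral_mono hJ hI hpt
  have hL : ∫ u : sphere (0 : EuclideanSpace ℝ (Fin 1)) 1,
      (1 - 2 * ⟪v, (u : EuclideanSpace ℝ (Fin 1))⟫ + ‖v‖ ^ 2) ∂(sphMeasure 1)
      = ((sphMeasure 1) univ).toReal * (1 + ‖v‖ ^ 2) := by
    rw [integral_add (cont_int hci3) (integrable_const _),
      integral_sub (integrable_const _) (cont_int hci2), integral_const_mul, sph_odd le_rfl]
    simp [measureReal_def]
    ring
  have hm2 : ((sphMeasure 1) univ).toReal * (1 + ‖v‖ ^ 2) ≤ ((sphMeasure 1) univ).toReal := by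
    rw [← hL]
    refine (hm.trans h).trans (le_of_eq ?_)
    simp [measureReal_def]
  have hpos := sph_pos (n := 1) le_rfl
  have hv0 : ‖v‖ ^ 2 ≤ 0 := by nlinarith
  have hv00 : v = 0 := by
    rw [← norm_eq_zero]
    exact pow_eq_zero_iff two_ne_zero |>.1 (le_antisymm hv0 (sq_nonneg _))
  intro u
  rw [hh u, hv00]; simp

lemma core_est {n : ℕ} (hn : 1 ≤ n) {h : sphere (0 : EuclideanSpace ℝ (Fin n)) 1 → ℝ}
    (hc : Continuous h) (hpos : ∀ u, 0 < h u) {D ε r : ℝ} (hε0 : 0 < ε) (hε1 : ε < 1)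
    (hD : ∀ u, h u ≤ D)
    (hI : ∫ u, h u ^ (-2 : ℝ) ∂(sphMeasure n) ≤ ((sphMeasure n) univ).toReal)
    (hJ : (1 - ε) * ((sphMeasure n) univ).toReal ≤ ∫ u, h u ^ (-1 : ℝ) ∂(sphMeasure n))
    (hr : r = ((sphMeasure n) univ).toReal ^ ((1 : ℝ) / 2) /
      (∫ u, h u ^ (-2 : ℝ) ∂(sphMeasure n)) ^ ((1 : ℝ) / 2)) :
    1 ≤ r ∧ r ≤ 1 / (1 - ε) ∧
      ∫ u, (h u - r) ^ 2 ∂(sphMeasure n) ≤ 2 * ((sphMeasure n) univ).toReal * ε * D ^ 2 := by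
  have hω := sph_pos hn
  have e2 : ∀ u, h u ^ (-2 : ℝ) = ((h u)⁻¹) ^ 2 := by
    intro u; rw [rpow_neg (hpos u).le, rpow_ofNat, inv_pow]
  have e1 : ∀ u, h u ^ (-1 : ℝ) = (h u)⁻¹ := fun u => rpow_neg_one _
  simp only [e2] at hI hr
  simp only [e1] at hJ
  have gc : Continuous (fun u => (h u)⁻¹) := hc.inv₀ (fun u => (hpos u).ne')
  have gc2 : Continuous (fun u => ((h u)⁻¹) ^ 2) := gc.pow 2
  have expand : ∀ s : ℝ, ∫ u, ((h u)⁻¹ - s) ^ 2 ∂(sphMeasure n) =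
      ∫ u, ((h u)⁻¹) ^ 2 ∂(sphMeasure n) - 2 * s * ∫ u, (h u)⁻¹ ∂(sphMeasure n)
        + s ^ 2 * ((sphMeasure n) univ).toReal := by
    intro s
    have hs : ∀ u, ((h u)⁻¹ - s) ^ 2 = ((h u)⁻¹) ^ 2 - 2 * s * (h u)⁻¹ + s ^ 2 := by intro u; ring
    simp only [hs]
    have c1 : Continuous (fun u => 2 * s * (h u)⁻¹) := continuous_const.mul gc
    have c2 : Continuous (fun u => ((h u)⁻¹) ^ 2 - 2 * s * (h u)⁻¹) := gc2.sub c1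
    rw [integral_add (cont_int c2) (integrable_const _), integral_sub (cont_int gc2) (cont_int c1),
      integral_const_mul]
    simp [measureReal_def, mul_comm]
  have nn : ∀ s : ℝ, 0 ≤ ∫ u, ((h u)⁻¹ - s) ^ 2 ∂(sphMeasure n) :=
    fun s => integral_nonneg (fun u => sq_nonneg _)
  set ω := ((sphMeasure n) univ).toReal
  set I := ∫ u, ((h u)⁻¹) ^ 2 ∂(sphMeasure n)
  set J := ∫ u, (h u)⁻¹ ∂(sphMeasure n)
  have hJ0 : 0 < J := lt_of_lt_of_le (mul_pos (by linarith) hω) hJ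
  have hI0 : 0 < I := by
    have h1 := nn (J / ω)
    rw [expand] at h1
    have : I - 2 * (J / ω) * J + (J / ω) ^ 2 * ω = I - J ^ 2 / ω := by field_simp; ring
    rw [this] at h1
    have : 0 < J ^ 2 / ω := by positivity
    linarith
  rw [← sqrt_eq_rpow, ← sqrt_eq_rpow, ← sqrt_div hω.le] at hr
  have hr0 : 0 < r := by rw [hr]; exact sqrt_pos.2 (by positivity)
  have hr2 : r ^ 2 = ω / I := by rw [hr]; exact sq_sqrt (by positivity)
  obtain ⟨s, hs⟩ : ∃ s, s = r⁻¹ := ⟨_, rfl⟩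
  have hs0 : 0 < s := by rw [hs]; positivity
  have hrs : r * s = 1 := by rw [hs]; field_simp
  have hIs : I = ω * s ^ 2 := by
    rw [hs, inv_pow, hr2]; field_simp
  have hr1 : 1 ≤ r := by
    rw [hr, one_le_sqrt, le_div_iff₀ hI0]; linarith
  have hs1 : s ≤ 1 := by rw [hs]; exact inv_le_one_of_one_le₀ hr1
  have h2 := nn s
  have h2e := expand s
  rw [h2e] at h2
  have hJs : J ≤ s * ω := by
    rw [hIs] at h2
    have : 0 ≤ 2 * s * (s * ω - J) := by linarith
    have := nonneg_of_mul_nonneg_right this (by positivity)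
    linarith
  have hse : 1 - ε ≤ s := by
    have : (1 - ε) * ω ≤ s * ω := hJ.trans hJs
    exact le_of_mul_le_mul_right this hω
  refine ⟨hr1, ?_, ?_⟩
  · rw [le_div_iff₀ (by linarith)]
    calc r * (1 - ε) ≤ r * s := mul_le_mul_of_nonneg_left hse hr0.le
      _ = 1 := hrs
  have h3 : ∫ u, ((h u)⁻¹ - s) ^ 2 ∂(sphMeasure n) ≤ 2 * ω * ε * s ^ 2 := by
    rw [h2e, hIs]
    have a1 : 2 * s * ((1 - ε) * ω) ≤ 2 * s * J := mul_le_mul_of_nonneg_left hJ (by positivity)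
    have a2 : 0 ≤ (2 * s * ω) * ((1 - ε) * (1 - s)) :=
      mul_nonneg (by positivity) (mul_nonneg (by linarith) (by linarith))
    nlinarith
  have pw : ∀ u, (h u - r) ^ 2 ≤ D ^ 2 * r ^ 2 * ((h u)⁻¹ - s) ^ 2 := by
    intro u
    have hu := hpos u
    have : (h u - r) ^ 2 = (h u) ^ 2 * r ^ 2 * ((h u)⁻¹ - s) ^ 2 := by
      rw [hs]; field_simp; ring
    rw [this]
    gcongr
    exact hD u
  have cL : Continuous (fun u => (h u - r) ^ 2) := (hc.sub continuous_const).pow 2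
  have cR : Continuous (fun u => D ^ 2 * r ^ 2 * ((h u)⁻¹ - s) ^ 2) :=
    continuous_const.mul ((gc.sub continuous_const).pow 2)
  have hm := integral_mono (cont_int cL) (cont_int cR) pw
  rw [integral_const_mul] at hm
  refine hm.trans ?_
  have h4 := mul_le_mul_of_nonneg_left h3 (by positivity : 0 ≤ D ^ 2 * r ^ 2)
  refine h4.trans (le_of_eq ?_)
  have : r ^ 2 * s ^ 2 = 1 := by rw [← mul_pow, hrs, one_pow]
  calc D ^ 2 * r ^ 2 * (2 * ω * ε * s ^ 2) = 2 * ω * ε * D ^ 2 * (r ^ 2 * s ^ 2) := by ring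
    _ = _ := by rw [this, mul_one]

lemma ent_le {n : ℕ} (hn : 1 ≤ n) {ε : ℝ} {K : Set (EuclideanSpace ℝ (Fin n))} (hK : IsConvexBody K)
    (hent : entropyP (-1) K / (n * vol (unitBall n)) ≥ 1 - ε)
    {e : EuclideanSpace ℝ (Fin n)} (he : e ∈ interior K) :
    (1 - ε) * ((sphMeasure n) univ).toReal ≤
      ∫ u, (supp K u - ⟪e, (u : EuclideanSpace ℝ (Fin n))⟫) ^ (-1 : ℝ) ∂(sphMeasure n) := by
  rw [← sph_total, ge_iff_le, le_div_iff₀ (sph_pos hn)] at hent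
  refine hent.trans ?_
  apply csInf_le
  · refine ⟨0, ?_⟩
    rintro _ ⟨x, hx, rfl⟩
    exact integral_nonneg (fun u => rpow_nonneg (hfun_pos hK.1 hx u).le _)
  · exact ⟨e, he, rfl⟩

lemma main_ge_two {m : ℕ} (hm : 1 ≤ m) (ε : ℝ) (hε0 : 0 < ε) (hε1 : ε < 1)
    (K : Set (EuclideanSpace ℝ (Fin (m + 1)))) (hK : IsConvexBody K)
    (hvol : vol K = vol (unitBall (m + 1)))
    (hent : entropyP (-1) K / ((m + 1 : ℕ) * vol (unitBall (m + 1))) ≥ 1 - ε)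
    (e₂ : EuclideanSpace ℝ (Fin (m + 1))) (he₂ : e₂ ∈ interior K)
    (he₂min : ∀ x ∈ interior K,
      (∫ u, (supp K u - ⟪e₂, (u : EuclideanSpace ℝ (Fin (m + 1)))⟫) ^ (-2 : ℝ) ∂(sphMeasure (m + 1)))
        ≤ ∫ u, (supp K u - ⟪x, (u : EuclideanSpace ℝ (Fin (m + 1)))⟫) ^ (-2 : ℝ)
          ∂(sphMeasure (m + 1))) :
    (1 ≤ rConst K e₂ ∧ rConst K e₂ ≤ 1 / (1 - ε)) ∧
    hdist ((fun x => x - e₂) '' K) (Metric.closedBall 0 (rConst K e₂)) ^ (m + 2)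
      ≤ (2 * (m + 1 : ℕ) * vol (unitBall (m + 1)) / alphaConst (m + 1)) * Metric.diam K ^ 2
          * (Metric.diam K + 2 / (1 - ε)) ^ m * ε := by
  have hKc := hK.1
  have heK := interior_subset he₂
  have hne : K.Nonempty := ⟨e₂, heK⟩
  obtain ⟨x₀, hx₀, hx₀I⟩ := int_sq_le (by omega) hK hvol
  obtain ⟨h1, h2, h3⟩ := core_est (n := m + 1) (by omega) (hfun_cont hKc hne e₂)
    (hfun_pos hKc he₂) (D := diam K) hε0 hε1
    (fun u => by
      have := supp_upper hKc heK (u : EuclideanSpace ℝ (Fin (m + 1)))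
      rwa [mem_sphere_zero_iff_norm.1 u.2, mul_one] at this)
    ((he₂min x₀ hx₀).trans hx₀I) (ent_le (by omega) hK hent he₂) (r := rConst K e₂) rfl
  refine ⟨⟨h1, h2⟩, ?_⟩
  set r := rConst K e₂ with hr
  have hr0 : 0 ≤ r := by linarith
  have hAc : IsCompact ((fun x => x - e₂) '' K) := hKc.image (by fun_prop)
  have hAn : ((fun x => x - e₂) '' K).Nonempty := hne.image _
  have hBc := isCompact_closedBall (0 : EuclideanSpace ℝ (Fin (m + 1))) r
  have hBn : (closedBall (0 : EuclideanSpace ℝ (Fin (m + 1))) r).Nonempty := ⟨0, by simpa using hr0⟩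
  have hdd : ∀ x ∈ (fun x => x - e₂) '' K, ∀ y ∈ closedBall (0 : EuclideanSpace ℝ (Fin (m + 1))) r,
      ‖x - y‖ ≤ diam K + 2 / (1 - ε) := by
    rintro _ ⟨x, hx, rfl⟩ y hy
    have a1 : ‖x - e₂‖ ≤ diam K := by
      rw [← dist_eq_norm]; exact dist_le_diam_of_mem hKc.isBounded hx heK
    have a2 : ‖y‖ ≤ r := by simpa using hy
    have a3 : 1 / (1 - ε) ≤ 2 / (1 - ε) :=
      div_le_div_of_nonneg_right (by norm_num) (by linarith)
    have := norm_sub_le (x - e₂) y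
    simp only
    linarith
  set D' := diam K + 2 / (1 - ε) with hD'
  have hD'0 : 0 ≤ D' := add_nonneg diam_nonneg (div_nonneg (by norm_num) (by linarith))
  have hα := alpha_pos hm
  have hS : ∀ u : sphere (0 : EuclideanSpace ℝ (Fin (m + 1))) 1,
      supp ((fun x => x - e₂) '' K) u - supp (closedBall (0 : EuclideanSpace ℝ (Fin (m + 1))) r) u =
        supp K u - ⟪e₂, (u : EuclideanSpace ℝ (Fin (m + 1)))⟫ - r := by
    intro u
    rw [supp_translate hKc hne, supp_ball hr0 (mem_sphere_zero_iff_norm.1 u.2)]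
  have hintA : ∫ u : sphere (0 : EuclideanSpace ℝ (Fin (m + 1))) 1,
      (supp ((fun x => x - e₂) '' K) u - supp (closedBall (0 : EuclideanSpace ℝ (Fin (m + 1))) r) u) ^ 2 ∂(sphMeasure (m + 1))
        ≤ 2 * ((sphMeasure (m + 1)) univ).toReal * ε * diam K ^ 2 := by
    simp only [hS]; exact h3
  set A := (fun x => x - e₂) '' K
  set Bb := closedBall (0 : EuclideanSpace ℝ (Fin (m + 1))) r
  have hintB : ∫ u : sphere (0 : EuclideanSpace ℝ (Fin (m + 1))) 1,
      (supp Bb u - supp A u) ^ 2 ∂(sphMeasure (m + 1))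
        ≤ 2 * ((sphMeasure (m + 1)) univ).toReal * ε * diam K ^ 2 := by
    have hsw : ∀ u : sphere (0 : EuclideanSpace ℝ (Fin (m + 1))) 1,
        (supp Bb u - supp A u) ^ 2 = (supp A u - supp Bb u) ^ 2 := fun u => by ring
    simp only [hsw]; exact hintA
  have hωe : 2 * ((m + 1 : ℕ) : ℝ) * vol (unitBall (m + 1)) =
      2 * ((sphMeasure (m + 1)) univ).toReal := by rw [sph_total]; ring
  rw [hωe]
  set ω := ((sphMeasure (m + 1)) univ).toReal
  have hω0 : 0 < ω := sph_pos (by omega)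
  set R := 2 * ω / alphaConst (m + 1) * diam K ^ 2 * D' ^ m * ε with hR
  have hR0 : 0 ≤ R := by positivity
  have fin : ∀ δ : ℝ, alphaConst (m + 1) * δ ≤ D' ^ m * (2 * ω * ε * diam K ^ 2) → δ ≤ R := by
    intro δ hδ
    have : R = D' ^ m * (2 * ω * ε * diam K ^ 2) / alphaConst (m + 1) := by
      rw [hR]; field_simp
    rw [this, le_div_iff₀ hα]
    linarith
  have each : ∀ u : sphere (0 : EuclideanSpace ℝ (Fin (m + 1))) 1,
      |supp A u - supp Bb u| ^ (m + 2) ≤ R := by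
    intro u
    have hu := mem_sphere_zero_iff_norm.1 u.2
    rcases lt_trichotomy (supp A u - supp Bb u) 0 with hlt | heq | hgt
    · rw [abs_of_neg hlt, neg_sub]
      apply fin
      refine (vitale hm hBc hBn hAc hAn (D := D') (fun x hx y hy => ?_) hu (by linarith)).trans
        (mul_le_mul_of_nonneg_left hintB (by positivity))
      rw [norm_sub_rev]; exact hdd y hy x hx
    · rw [heq]; simpa using hR0
    · rw [abs_of_pos hgt]
      apply fin
      exact (vitale hm hAc hAn hBc hBn (D := D') hdd hu hgt).trans
        (mul_le_mul_of_nonneg_left hintA (by positivity))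
  have hnz : m + 2 ≠ 0 := by omega
  have hroot : (R ^ (((m + 2 : ℕ) : ℝ)⁻¹)) ^ (m + 2) = R := rpow_inv_natCast_pow hR0 hnz
  have hle : hdist A Bb ≤ R ^ (((m + 2 : ℕ) : ℝ)⁻¹) := by
    refine Real.iSup_le (fun u => ?_) (rpow_nonneg hR0 _)
    refine le_of_pow_le_pow_left₀ hnz (rpow_nonneg hR0 _) ?_
    rw [hroot]
    exact each u
  calc hdist A Bb ^ (m + 2) ≤ (R ^ (((m + 2 : ℕ) : ℝ)⁻¹)) ^ (m + 2) :=
        pow_le_pow_left₀ (Real.iSup_nonneg (fun u => abs_nonneg _)) hle _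
    _ = R := hroot

/-- Lemma 3.2 of the paper. -/
theorem statement1 (n : ℕ) (hn : 1 ≤ n) (ε : ℝ) (hε0 : 0 < ε) (hε1 : ε < 1)
    (K : Set (EuclideanSpace ℝ (Fin n))) (hK : IsConvexBody K)
    (hvol : vol K = vol (unitBall n))
    (hent : entropyP (-1) K / (n * vol (unitBall n)) ≥ 1 - ε)
    (e₂ : EuclideanSpace ℝ (Fin n)) (he₂ : e₂ ∈ interior K)
    (he₂min : ∀ x ∈ interior K,
      (∫ u, (supp K u - ⟪e₂, (u : EuclideanSpace ℝ (Fin n))⟫) ^ (-2 : ℝ) ∂(sphMeasure n))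
        ≤ ∫ u, (supp K u - ⟪x, (u : EuclideanSpace ℝ (Fin n))⟫) ^ (-2 : ℝ) ∂(sphMeasure n)) :
    (1 ≤ rConst K e₂ ∧ rConst K e₂ ≤ 1 / (1 - ε)) ∧
    hdist ((fun x => x - e₂) '' K) (Metric.closedBall 0 (rConst K e₂)) ^ (n + 1)
      ≤ (2 * n * vol (unitBall n) / alphaConst n) * Metric.diam K ^ 2
          * (Metric.diam K + 2 / (1 - ε)) ^ (n - 1) * ε := by
  obtain ⟨m, rfl⟩ : ∃ m, n = m + 1 := ⟨n - 1, by omega⟩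
  rcases Nat.eq_zero_or_pos m with rfl | hm
  · have h1 := one_dim hK hvol he₂ he₂min
    have hne : K.Nonempty := ⟨e₂, interior_subset he₂⟩
    have hr : rConst K e₂ = 1 := by
      unfold rConst
      have hpos := sph_pos (n := 1) le_rfl
      have hi : ∫ u : sphere (0 : EuclideanSpace ℝ (Fin 1)) 1,
          (supp K u - ⟪e₂, (u : EuclideanSpace ℝ (Fin 1))⟫) ^ (-2 : ℝ) ∂(sphMeasure 1) =
          ((sphMeasure 1) univ).toReal := by
        simp only [h1, one_rpow]
        simp [measureReal_def]
      have hne0 : ((sphMeasure 1) univ).toReal ^ ((1 : ℝ) / 2) ≠ 0 := (rpow_pos_of_pos hpos _).ne'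
      exact (congrArg (fun t : ℝ => ((sphMeasure 1) univ).toReal ^ ((1 : ℝ) / 2) /
        t ^ ((1 : ℝ) / 2)) hi).trans (div_self hne0)
    rw [hr]
    refine ⟨⟨le_rfl, ?_⟩, ?_⟩
    · rw [le_div_iff₀ (by linarith)]; linarith
    · have hd : hdist ((fun x => x - e₂) '' K) (closedBall 0 1) = 0 := by
        unfold hdist
        have : ∀ u : sphere (0 : EuclideanSpace ℝ (Fin (0 + 1))) 1,
            |supp ((fun x => x - e₂) '' K) u - supp (closedBall (0 : EuclideanSpace ℝ (Fin (0 + 1))) 1) u| = 0 := by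
          intro u
          rw [supp_translate hK.1 hne, supp_ball zero_le_one (mem_sphere_zero_iff_norm.1 u.2)]
          have := h1 u
          rw [abs_eq_zero]
          linarith
        simp only [this, Real.iSup_const_zero]
      rw [hd]
      have ha : alphaConst (0 + 1) = 0 := alpha_one
      rw [ha]
      simp
  · exact main_ge_two hm ε hε0 hε1 K hK hvol hent e₂ he₂ he₂min
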